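/- arXiv:1810.09250 — 5 statements merged into one kernel-verified Lean document; each statement's English description precedes it below -/
import Mathlib

section
/- Let ε ∈ (0,1) and let X ⊂ ℝ^d be a finite set of size n > 1. Then there exist a natural number m ≤ C·ε⁻²·log n (for a universal constant C) and a map f : ℝ^d → ℝ^m such that for every x ∈ X and every y ∈ ℝ^d, ‖x − y‖₂ ≤ ‖f(x) − f(y)‖₂ ≤ (1 + ε)·‖x − y‖₂. -/
open MeasureTheory ProbabilityTheory

lemma te_sq_le {a b : ℝ} (h : a ^ 2 ≤ b ^ 2) (hb : 0 ≤ b) : a ≤ b :=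
  le_of_abs_le (abs_le_of_sq_le_sq h hb)

/-- separation argument -/
lemma te_minimax {ι V W : Type*} [Fintype ι] [NormedAddCommGroup V] [InnerProductSpace ℝ V]
    [NormedAddCommGroup W] [InnerProductSpace ℝ W] [FiniteDimensional ℝ W]
    (t : ι → V) (A : V →ₗ[ℝ] W) (η : ℝ)
    (h : ∀ l : ι → ℝ, (∀ i, 0 ≤ l i) →
      ‖∑ i, l i • t i‖ - η * ∑ i, l i ≤ ‖A (∑ i, l i • t i)‖) (u : V) :
    ∃ v : W, ‖v‖ ≤ ‖u‖ ∧ ∀ i, inner ℝ u (t i) - η * ‖u‖ ≤ inner ℝ v (A (t i)) := by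
  classical
  by_contra hcon
  push Not at hcon
  let B : W →ₗ[ℝ] (ι → ℝ) := LinearMap.pi fun i => (innerₗ W) (A (t i))
  have hB : ∀ v i, B v i = inner ℝ v (A (t i)) := fun v i => by
    simp [B, real_inner_comm]
  let D : Set (ι → ℝ) := Set.Ici (fun i => inner ℝ u (t i) - η * ‖u‖)
  obtain ⟨f, a, b, hfa, hab, hfb⟩ := geometric_hahn_banach_compact_closed
    (s := B '' Metric.closedBall 0 ‖u‖) (t := D)
    ((convex_closedBall _ _).linear_image B)
    ((isCompact_closedBall _ _).image B.continuous_of_finiteDimensional)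
    (convex_Ici _) isClosed_Ici (by
      rw [Set.disjoint_left]
      rintro _ ⟨v, hv, rfl⟩ hD
      obtain ⟨i, hi⟩ := hcon v (by simpa using hv)
      have := hD i
      rw [hB] at this
      simp only at this
      linarith)
  set c : ι → ℝ := fun i => inner ℝ u (t i) - η * ‖u‖ with hc
  set l : ι → ℝ := fun i => f (Pi.single i 1) with hl
  have hf : ∀ w, f w = ∑ i, w i * l i := by
    intro w
    conv_lhs => rw [pi_eq_sum_univ' w]
    simp [map_sum, hl]
  have hl0 : ∀ i, 0 ≤ l i := by
    intro i
    by_contra hneg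
    push Not at hneg
    -- go far in direction i
    set s : ℝ := (|f c - b| + 1) / (-(l i)) with hs
    have hs0 : 0 ≤ s := by
      apply div_nonneg (by positivity) (by linarith)
    have := hfb (c + s • Pi.single i 1) (by
      intro j
      have : 0 ≤ (s • Pi.single (M := fun _ => ℝ) i 1) j := by
        by_cases hj : j = i
        · subst hj; simpa using hs0
        · simp [hj]
      change c j ≤ c j + _
      linarith)
    rw [map_add, map_smul] at this
    have h2 : s • f (Pi.single i 1) = -(|f c - b| + 1) := by
      change s * l i = _
      rw [hs, div_mul_eq_mul_div, div_neg, mul_div_cancel_right₀ _ hneg.ne]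
    rw [h2] at this
    have := le_abs_self (f c - b)
    linarith
  set x := ∑ i, l i • t i with hx
  have hAx : A x = ∑ i, l i • A (t i) := by simp [hx]
  have h1 : f c = inner ℝ u x - η * ‖u‖ * ∑ i, l i := by
    rw [hf, hx, inner_sum, Finset.mul_sum, ← Finset.sum_sub_distrib]
    refine Finset.sum_congr rfl fun i _ => ?_
    rw [inner_smul_right]; simp only [hc]; ring
  have h2 := hfb c (Set.mem_Ici.2 le_rfl)
  have h3 : ∀ v : W, f (B v) = inner ℝ v (A x) := by
    intro v
    rw [hf, hAx, inner_sum]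
    refine Finset.sum_congr rfl fun i _ => ?_
    rw [inner_smul_right, hB]; ring
  have h4 : ‖u‖ * ‖A x‖ < a := by
    by_cases h0 : ‖A x‖ = 0
    · have := hfa (B 0) ⟨0, by simp, rfl⟩
      rw [h3] at this
      simpa [h0] using this
    · have := hfa (B ((‖u‖ / ‖A x‖) • A x)) ⟨_, by
        simp [norm_smul, div_mul_cancel₀ _ h0], rfl⟩
      rw [h3, inner_smul_left, real_inner_self_eq_norm_sq] at this
      have e : (‖u‖ / ‖A x‖) * ‖A x‖ ^ 2 = ‖u‖ * ‖A x‖ := by field_simp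
      simp only [conj_trivial] at this
      linarith
  have h5 := h l hl0
  have h6 := real_inner_le_norm u x
  have h7 := mul_le_mul_of_nonneg_left h5 (norm_nonneg u)
  nlinarith

lemma te_gauss {d : ℕ} (z : EuclideanSpace ℝ (Fin d)) (hz : ‖z‖ = 1) (c : ℝ) (hc : c < 1 / 2) :
    Integrable (fun g => Real.exp (c * (inner ℝ z g) ^ 2)) (stdGaussian (EuclideanSpace ℝ (Fin d))) ∧
    ∫ g, Real.exp (c * (inner ℝ z g) ^ 2) ∂(stdGaussian (EuclideanSpace ℝ (Fin d)))
      = (√(1 - 2 * c))⁻¹ := by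
  have hmap : (stdGaussian (EuclideanSpace ℝ (Fin d))).map (fun g => inner ℝ z g) = gaussianReal 0 1 := by
    have := IsGaussian.map_eq_gaussianReal (μ := stdGaussian (EuclideanSpace ℝ (Fin d))) (innerSL ℝ z)
    rw [integral_strongDual_stdGaussian, variance_dual_stdGaussian, innerSL_apply_norm, hz] at this
    simpa using this
  have hm : AEMeasurable (fun g : EuclideanSpace ℝ (Fin d) => (inner ℝ z g : ℝ)) (stdGaussian (EuclideanSpace ℝ (Fin d))) := by
    fun_prop
  have key : ∀ x : ℝ, gaussianPDFReal 0 1 x * Real.exp (c * x ^ 2)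
      = (√(2 * Real.pi))⁻¹ * Real.exp (-(1/2 - c) * x ^ 2) := by
    intro x
    simp only [gaussianPDFReal, NNReal.coe_one, sub_zero, mul_one]
    rw [mul_assoc, ← Real.exp_add]
    ring_nf
  have hs : AEStronglyMeasurable (fun x : ℝ => Real.exp (c * x ^ 2)) (gaussianReal 0 1) := by
    fun_prop
  constructor
  · rw [← hmap] at hs
    have := (integrable_map_measure hs hm).1
    refine this ?_
    rw [hmap, gaussianReal_of_var_ne_zero _ (by simp)]
    rw [integrable_withDensity_iff_integrable_smul₀' (by fun_prop) (by simp [gaussianPDF])]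
    have : (fun x : ℝ => (gaussianPDF 0 1 x).toReal • Real.exp (c * x ^ 2))
      = fun x => (√(2 * Real.pi))⁻¹ * Real.exp (-(1/2 - c) * x ^ 2) := by
      ext x
      rw [toReal_gaussianPDF, smul_eq_mul, key]
    rw [this]
    exact (integrable_exp_neg_mul_sq (by linarith)).const_mul _
  · rw [← hmap] at hs
    have := integral_map hm hs
    rw [← this, hmap, integral_gaussianReal_eq_integral_smul (by simp)]
    simp only [smul_eq_mul, key]
    rw [integral_const_mul, integral_gaussian, ← Real.sqrt_inv, ← Real.sqrt_mul (by positivity), ← Real.sqrt_inv]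
    congr 1
    have : 1 - 2 * c ≠ 0 := by linarith
    have : 1 / 2 - c ≠ 0 := by linarith
    field_simp

lemma te_gauss_pi {d m : ℕ} (z : EuclideanSpace ℝ (Fin d)) (hz : ‖z‖ = 1) (c a : ℝ) (hc : c < 1 / 2) :
    Integrable (fun g : Fin m → EuclideanSpace ℝ (Fin d) =>
      Real.exp (a + c * ∑ i, (inner ℝ z (g i)) ^ 2))
      (Measure.pi fun _ => stdGaussian (EuclideanSpace ℝ (Fin d))) ∧
    ∫ g, Real.exp (a + c * ∑ i, (inner ℝ z (g i)) ^ 2)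
      ∂(Measure.pi fun _ : Fin m => stdGaussian (EuclideanSpace ℝ (Fin d)))
      = Real.exp a * ((√(1 - 2 * c))⁻¹) ^ m := by
  have : (fun g : Fin m → EuclideanSpace ℝ (Fin d) =>
      Real.exp (a + c * ∑ i, (inner ℝ z (g i)) ^ 2))
      = fun g => Real.exp a * ∏ i, Real.exp (c * (inner ℝ z (g i)) ^ 2) := by
    ext g
    rw [Real.exp_add, Finset.mul_sum, Real.exp_sum]
  obtain ⟨h1, h2⟩ := te_gauss z hz c hc
  rw [this]
  constructor
  · exact (Integrable.fintype_prod (f := fun _ g => Real.exp (c * (inner ℝ z g) ^ 2)) (fun _ => h1)).const_mul _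
  · rw [integral_const_mul, integral_fintype_prod_eq_pow (fun g => Real.exp (c * (inner ℝ z g) ^ 2)), h2]
    simp

/-- lower tail -/
lemma te_low (δ : ℝ) (hδ : 0 ≤ δ) (m : ℕ) :
    Real.exp (δ / 2 * ((1 - δ) * m)) * ((√(1 - 2 * (-(δ/2))))⁻¹) ^ m ≤ Real.exp (-(δ ^ 2 / 4 * m)) := by
  have h0 : 0 < 1 + δ := by linarith
  have h : Real.exp (δ / 2 - δ ^ 2 / 4) ≤ √(1 + δ) := by
    apply Real.le_sqrt_of_sq_le
    rw [← Real.exp_nat_mul]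
    have : δ - δ ^ 2 / 2 ≤ Real.log (1 + δ) := by
      refine le_trans ?_ (Real.le_log_one_add_of_nonneg hδ)
      rw [le_div_iff₀ (by linarith)]
      nlinarith [pow_nonneg hδ 3]
    calc _ ≤ Real.exp (Real.log (1 + δ)) := Real.exp_le_exp.2 (by push_cast; linarith)
      _ = _ := Real.exp_log h0
  have h' : (√(1 - 2 * (-(δ/2))))⁻¹ ≤ Real.exp (-(δ / 2 - δ ^ 2 / 4)) := by
    rw [Real.exp_neg]
    have e : 1 - 2 * (-(δ/2)) = 1 + δ := by ring
    rw [e]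
    exact inv_anti₀ (Real.exp_pos _) h
  calc _ ≤ Real.exp (δ / 2 * ((1 - δ) * m)) * (Real.exp (-(δ / 2 - δ ^ 2 / 4))) ^ m := by gcongr
    _ = _ := by
      rw [← Real.exp_nat_mul, ← Real.exp_add]; ring_nf

lemma te_up (δ : ℝ) (hδ : 0 ≤ δ) (hδ1 : δ ≤ 1) (m : ℕ) :
    Real.exp (-(δ / 8 * ((1 + δ) * m))) * ((√(1 - 2 * (δ/8)))⁻¹) ^ m ≤ Real.exp (-(δ ^ 2 / 16 * m)) := by
  have h0 : 0 < 1 - δ / 4 := by linarith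
  have h : Real.exp (-(δ / 8 + δ ^ 2 / 16)) ≤ √(1 - δ / 4) := by
    apply Real.le_sqrt_of_sq_le
    rw [← Real.exp_nat_mul]
    have : -(δ / 4 + δ ^ 2 / 8) ≤ Real.log (1 - δ / 4) := by
      have := Real.one_sub_inv_le_log_of_pos h0
      refine le_trans ?_ this
      rw [le_sub_iff_add_le, ← le_sub_iff_add_le', inv_le_iff_one_le_mul₀ h0]
      nlinarith [sq_nonneg δ, mul_nonneg (sq_nonneg δ) (sub_nonneg.2 hδ1)]
    calc _ ≤ Real.exp (Real.log (1 - δ / 4)) := Real.exp_le_exp.2 (by push_cast; linarith)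
      _ = _ := Real.exp_log h0
  have h' : (√(1 - 2 * (δ/8)))⁻¹ ≤ Real.exp ((δ / 8 + δ ^ 2 / 16)) := by
    have e : 1 - 2 * (δ/8) = 1 - δ / 4 := by ring
    rw [e]
    have := inv_anti₀ (Real.exp_pos _) h
    rwa [← Real.exp_neg, neg_neg] at this
  calc _ ≤ Real.exp (-(δ / 8 * ((1 + δ) * m))) * (Real.exp ((δ / 8 + δ ^ 2 / 16))) ^ m := by gcongr
    _ = _ := by
      rw [← Real.exp_nat_mul, ← Real.exp_add]; ring_nf

lemma te_sum_cons {ι M : Type*} [Fintype ι] [AddCommMonoid M] (K : ℕ) (F : (Fin (K + 1) → ι) → M) :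
    ∑ θ, F θ = ∑ i, ∑ θ : Fin K → ι, F (Fin.cons i θ) := by
  rw [← Fintype.sum_prod_type' (f := fun i (θ : Fin K → ι) => F (Fin.cons i θ))]
  exact (Fintype.sum_equiv (Fin.consEquiv (fun _ => ι)) _ _ (fun _ => rfl)).symm

/-- second moment of the empirical sums -/
lemma te_maurey {ι W : Type*} [Fintype ι] [NormedAddCommGroup W] [InnerProductSpace ℝ W]
    (s : ι → W) (l : ι → ℝ) (hl : ∑ i, l i = 1) (K : ℕ) :
    (∑ θ : Fin K → ι, ∏ k, l (θ k) = 1) ∧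
    (∑ θ : Fin K → ι, (∏ k, l (θ k)) • ∑ k, s (θ k) = (K : ℝ) • ∑ i, l i • s i) ∧
    (∑ θ : Fin K → ι, (∏ k, l (θ k)) * ‖∑ k, s (θ k)‖ ^ 2 =
      K * ∑ i, l i * ‖s i‖ ^ 2 + K * (K - 1) * ‖∑ i, l i • s i‖ ^ 2) := by
  induction K with
  | zero => simp
  | succ K ih =>
    obtain ⟨h1, h2, h3⟩ := ih
    refine ⟨?_, ?_, ?_⟩
    · rw [te_sum_cons]
      simp only [Fin.prod_univ_succ, Fin.cons_zero, Fin.cons_succ, ← Finset.mul_sum, h1, mul_one, hl]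
    · rw [te_sum_cons]
      simp only [Fin.prod_univ_succ, Fin.sum_univ_succ, Fin.cons_zero, Fin.cons_succ, smul_add, mul_smul,
        Finset.sum_add_distrib, ← Finset.smul_sum, h2, ← Finset.sum_smul, h1, hl, one_smul]
      push_cast
      rw [add_smul, one_smul, add_comm]
    · rw [te_sum_cons]
      have e : ∀ (i : ι) (θ : Fin K → ι), l i * (∏ k, l (θ k)) * ‖s i + ∑ k, s (θ k)‖ ^ 2
        = (l i * ‖s i‖ ^ 2) * (∏ k, l (θ k)) + 2 * (inner ℝ (l i • s i) ((∏ k, l (θ k)) • ∑ k, s (θ k)))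
          + l i * ((∏ k, l (θ k)) * ‖∑ k, s (θ k)‖ ^ 2) := by
        intro i θ
        rw [norm_add_sq_real, real_inner_smul_left, real_inner_smul_right]
        ring
      simp only [Fin.prod_univ_succ, Fin.sum_univ_succ, Fin.cons_zero, Fin.cons_succ, e,
        Finset.sum_add_distrib, ← Finset.mul_sum, ← inner_sum, h1, h2, h3, ← Finset.sum_mul, hl, ← sum_inner]
      rw [real_inner_smul_right, real_inner_self_eq_norm_sq]
      push_cast
      ring

lemma te_hull_one {ι V W : Type*} [Fintype ι] [NormedAddCommGroup V] [InnerProductSpace ℝ V]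
    [NormedAddCommGroup W] [InnerProductSpace ℝ W]
    (t : ι → V) (ht : ∀ i, ‖t i‖ ≤ 1) (A : V →ₗ[ℝ] W) (ε : ℝ) (hε : 0 < ε) (N : ℕ) (hN : 1 / ε ≤ N)
    (H : ∀ L : ℕ, 1 ≤ L → L ≤ N → ∀ θ : Fin (L ^ 2) → ι,
      (1 - ε * L) * ‖∑ k, t (θ k)‖ ^ 2 ≤ ‖A (∑ k, t (θ k))‖ ^ 2)
    (U : ∀ i, ‖A (t i)‖ ^ 2 ≤ (1 + ε) * ‖t i‖ ^ 2)
    (l : ι → ℝ) (hl0 : ∀ i, 0 ≤ l i) (hl : ∑ i, l i = 1) :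
    ‖∑ i, l i • t i‖ - 4 * ε ≤ ‖A (∑ i, l i • t i)‖ := by
  set x := ∑ i, l i • t i with hx
  set r := ‖x‖ with hr
  by_cases hr4 : r ≤ 4 * ε
  · have := norm_nonneg (A x); linarith
  push Not at hr4
  have hr0 : 0 < r := by linarith
  have hr1 : r ≤ 1 := by
    calc r ≤ ∑ i, ‖l i • t i‖ := norm_sum_le _ _
      _ ≤ ∑ i, l i := Finset.sum_le_sum fun i _ => by
        rw [norm_smul, Real.norm_of_nonneg (hl0 i)]
        exact mul_le_of_le_one_right (hl0 i) (ht i)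
      _ = 1 := hl
  set L : ℕ := ⌈1 / r⌉₊ + 1 with hL
  have hL1 : 1 / r ≤ (L : ℝ) - 1 := by
    rw [hL]; push_cast; have := Nat.le_ceil (1 / r); linarith
  have hL2 : (L : ℝ) ≤ 3 / r := by
    rw [hL]; push_cast
    have h := Nat.ceil_lt_add_one (a := 1 / r) (by positivity)
    have : 1 ≤ 1 / r := by rw [le_div_iff₀ hr0]; linarith
    have e : 3 / r = 3 * (1 / r) := by ring
    linarith
  have hLN : L ≤ N := by
    have : (L : ℝ) ≤ N := by
      refine hL2.trans (le_trans ?_ hN)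
      rw [div_le_div_iff₀ hr0 hε]
      linarith
    exact_mod_cast this
  have hH := H L (by omega) hLN
  obtain ⟨-, -, m1⟩ := te_maurey t l hl (L ^ 2)
  obtain ⟨-, -, m2⟩ := te_maurey (fun i => A (t i)) l hl (L ^ 2)
  have hAx : A x = ∑ i, l i • A (t i) := by simp [hx]
  rw [← hAx] at m2
  rw [← hx, ← hr] at m1
  have hS : (1 - ε * L) * ∑ θ : Fin (L ^ 2) → ι, (∏ k, l (θ k)) * ‖∑ k, t (θ k)‖ ^ 2
      ≤ ∑ θ : Fin (L ^ 2) → ι, (∏ k, l (θ k)) * ‖∑ k, A (t (θ k))‖ ^ 2 := by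
    rw [Finset.mul_sum]
    refine Finset.sum_le_sum fun θ _ => ?_
    have := mul_le_mul_of_nonneg_left (hH θ) (Finset.prod_nonneg (s := Finset.univ) fun k _ => hl0 (θ k))
    rw [map_sum] at this
    linarith
  rw [m1, m2] at hS
  push_cast at hS
  set S := ∑ i, l i * ‖t i‖ ^ 2 with hSdef
  have hS1 : S ≤ 1 := by
    rw [← hl]
    refine Finset.sum_le_sum fun i _ => mul_le_of_le_one_right (hl0 i) ?_
    exact pow_le_one₀ (norm_nonneg _) (ht i)
  have hS0 : 0 ≤ S := Finset.sum_nonneg fun i _ => mul_nonneg (hl0 i) (by positivity)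
  have hS' : ∑ i, l i * ‖A (t i)‖ ^ 2 ≤ (1 + ε) * S := by
    rw [hSdef, Finset.mul_sum]
    refine Finset.sum_le_sum fun i _ => ?_
    have := mul_le_mul_of_nonneg_left (U i) (hl0 i)
    linarith
  set Y := ‖A x‖ with hY
  have hLr1 : 1 ≤ r * ((L : ℝ) - 1) := by
    rw [div_le_iff₀ hr0] at hL1; linarith
  have hLr2 : r * (L : ℝ) ≤ 3 := by
    rw [le_div_iff₀ hr0] at hL2; linarith
  have hLpos : (1 : ℝ) < L := by nlinarith
  have hL2pos : (0 : ℝ) < (L : ℝ) ^ 2 := by positivity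
  have h1 : (1 - ε * L) * (S + ((L : ℝ) ^ 2 - 1) * r ^ 2) ≤ (1 + ε) * S + ((L : ℝ) ^ 2 - 1) * Y ^ 2 := by
    have : (L : ℝ) ^ 2 * ((1 - ε * L) * (S + ((L : ℝ) ^ 2 - 1) * r ^ 2)) ≤
      (L : ℝ) ^ 2 * ((1 + ε) * S + ((L : ℝ) ^ 2 - 1) * Y ^ 2) := by
      have := mul_le_mul_of_nonneg_left hS' hL2pos.le
      linarith
    exact le_of_mul_le_mul_left this hL2pos
  -- divide by L+1
  have h2 : ((L : ℝ) - 1) * ((1 - ε * L) * r ^ 2) - ε * S ≤ ((L : ℝ) - 1) * Y ^ 2 := by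
    have : ((L : ℝ) + 1) * (((L : ℝ) - 1) * ((1 - ε * L) * r ^ 2) - ε * S) ≤ ((L : ℝ) + 1) * (((L : ℝ) - 1) * Y ^ 2) := by
      linarith
    exact le_of_mul_le_mul_left this (by linarith)
  have h3 : (1 - ε * L) * r ^ 2 - ε * r ≤ Y ^ 2 := by
    have : ((L : ℝ) - 1) * ((1 - ε * L) * r ^ 2 - ε * r) ≤ ((L : ℝ) - 1) * Y ^ 2 := by
      have : ε * S ≤ ε * (r * ((L : ℝ) - 1)) := mul_le_mul_of_nonneg_left (by linarith) hε.le
      linarith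
    exact le_of_mul_le_mul_left this (by linarith)
  have h4 : r ^ 2 - 4 * ε * r ≤ Y ^ 2 := by
    have : ε * r * (r * L) ≤ ε * r * 3 := mul_le_mul_of_nonneg_left hLr2 (by positivity)
    linarith
  refine le_of_sq_le_sq ?_ (norm_nonneg _) 
  nlinarith

lemma te_hull {ι V W : Type*} [Fintype ι] [NormedAddCommGroup V] [InnerProductSpace ℝ V]
    [NormedAddCommGroup W] [InnerProductSpace ℝ W]
    (t : ι → V) (ht : ∀ i, ‖t i‖ ≤ 1) (A : V →ₗ[ℝ] W) (ε : ℝ) (hε : 0 < ε) (N : ℕ) (hN : 1 / ε ≤ N)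
    (H : ∀ L : ℕ, 1 ≤ L → L ≤ N → ∀ θ : Fin (L ^ 2) → ι,
      (1 - ε * L) * ‖∑ k, t (θ k)‖ ^ 2 ≤ ‖A (∑ k, t (θ k))‖ ^ 2)
    (U : ∀ i, ‖A (t i)‖ ^ 2 ≤ (1 + ε) * ‖t i‖ ^ 2)
    (l : ι → ℝ) (hl0 : ∀ i, 0 ≤ l i) :
    ‖∑ i, l i • t i‖ - 4 * ε * ∑ i, l i ≤ ‖A (∑ i, l i • t i)‖ := by
  set c := ∑ i, l i with hc
  have hc0 : 0 ≤ c := Finset.sum_nonneg fun i _ => hl0 i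
  rcases hc0.eq_or_lt with h0 | h0
  · have : ∀ i, l i = 0 := by
      intro i
      exact (Finset.sum_eq_zero_iff_of_nonneg (fun i _ => hl0 i)).1 (hc.symm.trans h0.symm) i (Finset.mem_univ i)
    simp [this, ← h0]
  · have := te_hull_one t ht A ε hε N hN H U (fun i => c⁻¹ * l i)
      (fun i => mul_nonneg (by positivity) (hl0 i)) (by
        rw [← Finset.mul_sum, ← hc]; exact inv_mul_cancel₀ h0.ne')
    simp only [mul_smul, ← Finset.smul_sum, map_smul, norm_smul] at this
    rw [Real.norm_of_nonneg (by positivity)] at this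
    have h2 := mul_le_mul_of_nonneg_left this hc0
    rw [mul_sub, mul_inv_cancel_left₀ h0.ne', mul_inv_cancel_left₀ h0.ne'] at h2
    linarith

lemma te_low_term {d m : ℕ} (z : EuclideanSpace ℝ (Fin d)) (δ : ℝ) (hδ : 0 ≤ δ) :
    ∃ F : (Fin m → EuclideanSpace ℝ (Fin d)) → ℝ, (∀ g, 0 ≤ F g) ∧
      Integrable F (Measure.pi fun _ => stdGaussian (EuclideanSpace ℝ (Fin d))) ∧
      ∫ g, F g ∂(Measure.pi fun _ => stdGaussian (EuclideanSpace ℝ (Fin d)))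
        ≤ Real.exp (-(δ ^ 2 / 4 * m)) ∧
      ∀ g, F g < 1 → (1 - δ) * m * ‖z‖ ^ 2 ≤ ∑ i, (inner ℝ z (g i)) ^ 2 := by
  by_cases hz : z = 0
  · exact ⟨fun _ => 0, by simp, by simp, by simpa using (Real.exp_pos _).le, by simp [hz]⟩
  have hz' : 0 < ‖z‖ := norm_pos_iff.2 hz
  set w := ‖z‖⁻¹ • z with hw
  have hw1 : ‖w‖ = 1 := by rw [hw, norm_smul, norm_inv, norm_norm]; exact inv_mul_cancel₀ hz'.ne'
  have hzw : z = ‖z‖ • w := by rw [hw, smul_smul, mul_inv_cancel₀ hz'.ne', one_smul]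
  obtain ⟨h1, h2⟩ := te_gauss_pi (m := m) w hw1 (-(δ / 2)) (δ / 2 * ((1 - δ) * m)) (by linarith)
  by_cases hd0 : δ = 0
  · refine ⟨fun _ => 1, by simp, by simp, by simp [hd0], by simp⟩
  refine ⟨_, fun g => (Real.exp_pos _).le, h1, h2.le.trans (te_low δ hδ m), fun g hg => ?_⟩
  rw [Real.exp_lt_one_iff] at hg
  have hd : 0 < δ / 2 := by positivity
  have h3 : (1 - δ) * m ≤ ∑ i, (inner ℝ w (g i)) ^ 2 := by
    refine le_of_mul_le_mul_left ?_ hd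
    linarith
  have h4 : ∑ i, (inner ℝ z (g i)) ^ 2 = ‖z‖ ^ 2 * ∑ i, (inner ℝ w (g i)) ^ 2 := by
    rw [Finset.mul_sum]
    refine Finset.sum_congr rfl fun i _ => ?_
    conv_lhs => rw [hzw, real_inner_smul_left, mul_pow]
  rw [h4]
  nlinarith [sq_nonneg ‖z‖]

lemma te_up_term {d m : ℕ} (z : EuclideanSpace ℝ (Fin d)) (δ : ℝ) (hδ : 0 ≤ δ) (hδ1 : δ ≤ 1) :
    ∃ F : (Fin m → EuclideanSpace ℝ (Fin d)) → ℝ, (∀ g, 0 ≤ F g) ∧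
      Integrable F (Measure.pi fun _ => stdGaussian (EuclideanSpace ℝ (Fin d))) ∧
      ∫ g, F g ∂(Measure.pi fun _ => stdGaussian (EuclideanSpace ℝ (Fin d)))
        ≤ Real.exp (-(δ ^ 2 / 16 * m)) ∧
      ∀ g, F g < 1 → ∑ i, (inner ℝ z (g i)) ^ 2 ≤ (1 + δ) * m * ‖z‖ ^ 2 := by
  by_cases hz : z = 0
  · exact ⟨fun _ => 0, by simp, by simp, by simpa using (Real.exp_pos _).le, by simp [hz]⟩
  have hz' : 0 < ‖z‖ := norm_pos_iff.2 hz
  set w := ‖z‖⁻¹ • z with hw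
  have hw1 : ‖w‖ = 1 := by rw [hw, norm_smul, norm_inv, norm_norm]; exact inv_mul_cancel₀ hz'.ne'
  have hzw : z = ‖z‖ • w := by rw [hw, smul_smul, mul_inv_cancel₀ hz'.ne', one_smul]
  obtain ⟨h1, h2⟩ := te_gauss_pi (m := m) w hw1 (δ / 8) (-(δ / 8 * ((1 + δ) * m))) (by linarith)
  by_cases hd0 : δ = 0
  · refine ⟨fun _ => 1, by simp, by simp, by simp [hd0], by simp⟩
  refine ⟨_, fun g => (Real.exp_pos _).le, h1, h2.le.trans (te_up δ hδ hδ1 m), fun g hg => ?_⟩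
  rw [Real.exp_lt_one_iff] at hg
  have hd : 0 < δ / 8 := by positivity
  have h3 : ∑ i, (inner ℝ w (g i)) ^ 2 ≤ (1 + δ) * m := by
    refine le_of_mul_le_mul_left ?_ hd
    linarith
  have h4 : ∑ i, (inner ℝ z (g i)) ^ 2 = ‖z‖ ^ 2 * ∑ i, (inner ℝ w (g i)) ^ 2 := by
    rw [Finset.mul_sum]
    refine Finset.sum_congr rfl fun i _ => ?_
    conv_lhs => rw [hzw, real_inner_smul_left, mul_pow]
  rw [h4]
  nlinarith [sq_nonneg ‖z‖]

lemma te_union {Ω J : Type*} [MeasurableSpace Ω] (μ : Measure Ω) [IsProbabilityMeasure μ] [Fintype J]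
    (F : J → Ω → ℝ) (b : J → ℝ) (h0 : ∀ j g, 0 ≤ F j g) (hi : ∀ j, Integrable (F j) μ)
    (hb : ∀ j, ∫ g, F j g ∂μ ≤ b j) (hs : ∑ j, b j < 1) : ∃ g, ∀ j, F j g < 1 := by
  obtain ⟨g, hg⟩ := exists_le_integral (μ := μ) (f := fun g => ∑ j, F j g)
    (integrable_finsetSum _ fun j _ => hi j)
  refine ⟨g, fun j => ?_⟩
  rw [integral_finsetSum _ fun j _ => hi j] at hg
  calc F j g ≤ ∑ j, F j g := Finset.single_le_sum (f := fun j => F j g) (fun j _ => h0 j g) (Finset.mem_univ j)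
    _ ≤ ∑ j, b j := hg.trans (Finset.sum_le_sum fun j _ => hb j)
    _ < 1 := hs

lemma te_random {d m n : ℕ} {ι : Type*} [Fintype ι] (hn : 2 ≤ n) (hι : Fintype.card ι = n ^ 2)
    (t : ι → EuclideanSpace ℝ (Fin d)) (ε : ℝ) (hε : 0 < ε) (hε1 : ε ≤ 1)
    (hm : 64 * Real.log n ≤ ε ^ 2 * m) (N : ℕ) :
    ∃ A : EuclideanSpace ℝ (Fin d) →ₗ[ℝ] EuclideanSpace ℝ (Fin m),
      (∀ L : ℕ, 1 ≤ L → L ≤ N → ∀ θ : Fin (L ^ 2) → ι,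
        (1 - ε * L) * ‖∑ k, t (θ k)‖ ^ 2 ≤ ‖A (∑ k, t (θ k))‖ ^ 2) ∧
      (∀ i, ‖A (t i)‖ ^ 2 ≤ (1 + ε) * ‖t i‖ ^ 2) := by
  classical
  have hn' : (2 : ℝ) ≤ n := by exact_mod_cast hn
  have hlog : 0 < Real.log n := Real.log_pos (by linarith)
  have hm0 : (0 : ℝ) < m := by
    by_contra hneg
    have : (m : ℝ) = 0 := le_antisymm (not_lt.1 hneg) (by positivity)
    rw [this] at hm
    linarith
  set q := Real.exp (-(ε ^ 2 / 16 * m)) with hq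
  have hq0 : 0 < q := Real.exp_pos _
  have hnq : (n : ℝ) ^ 2 * q ≤ 1 / 4 := by
    have h1 : q ≤ ((n : ℝ) ^ 4)⁻¹ := by
      rw [← Real.exp_log (show (0 : ℝ) < n by linarith), ← Real.exp_nat_mul, ← Real.exp_neg, hq]
      apply Real.exp_le_exp.2
      push_cast
      linarith
    calc (n : ℝ) ^ 2 * q ≤ (n : ℝ) ^ 2 * ((n : ℝ) ^ 4)⁻¹ := by gcongr
      _ = ((n : ℝ) ^ 2)⁻¹ := by field_simp
      _ ≤ ((2 : ℝ) ^ 2)⁻¹ := by gcongr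
      _ = _ := by norm_num
  choose Fl l0 li lb lc using fun (j : Σ L : Fin N, (Fin (((L : ℕ) + 1) ^ 2) → ι)) =>
    te_low_term (m := m) (∑ k, t (j.2 k)) (ε * ((j.1 : ℕ) + 1 : ℕ)) (by positivity)
  choose Fu u0 ui ub uc using fun i => te_up_term (m := m) (t i) ε hε.le hε1
  obtain ⟨g, hg⟩ := te_union (Measure.pi fun _ : Fin m => stdGaussian (EuclideanSpace ℝ (Fin d)))
    (Sum.elim Fl Fu)
    (Sum.elim (fun j => Real.exp (-((ε * ((j.1 : ℕ) + 1 : ℕ)) ^ 2 / 4 * m))) (fun _ => q))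
    (by rintro (j | j); exacts [l0 j, u0 j])
    (by rintro (j | j); exacts [li j, ui j])
    (by rintro (j | j); exacts [lb j, ub j])
    (by
      rw [Fintype.sum_sum_type, Fintype.sum_sigma]
      simp only [Sum.elim_inl, Sum.elim_inr, Finset.sum_const, Finset.card_univ, nsmul_eq_mul,
        Fintype.card_fun, Fintype.card_fin, hι]
      have hterm : ∀ L : ℕ, (((n ^ 2) ^ ((L + 1) ^ 2) : ℕ) : ℝ) *
          Real.exp (-((ε * (L + 1 : ℕ)) ^ 2 / 4 * m)) ≤ (1 / 4 : ℝ) ^ (L + 1) := by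
        intro L
        have h1 : Real.exp (-((ε * (L + 1 : ℕ)) ^ 2 / 4 * m)) ≤ q ^ ((L + 1) ^ 2) := by
          rw [hq, ← Real.exp_nat_mul]
          apply Real.exp_le_exp.2
          push_cast
          have : 0 ≤ ε ^ 2 * m * ((L : ℝ) + 1) ^ 2 := by positivity
          nlinarith
        calc _ ≤ (((n ^ 2) ^ ((L + 1) ^ 2) : ℕ) : ℝ) * q ^ ((L + 1) ^ 2) := by gcongr
          _ = ((n : ℝ) ^ 2 * q) ^ ((L + 1) ^ 2) := by push_cast; rw [mul_pow]
          _ ≤ (1 / 4 : ℝ) ^ ((L + 1) ^ 2) := by gcongr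
          _ ≤ _ := pow_le_pow_of_le_one (by norm_num) (by norm_num) (by nlinarith)
      have hsum : ∀ N : ℕ, ∑ L ∈ Finset.range N, (1 / 4 : ℝ) ^ (L + 1) = 1 / 3 * (1 - (1 / 4) ^ N) := by
        intro N
        induction N with
        | zero => simp
        | succ k ih => rw [Finset.sum_range_succ, ih]; ring
      have h1 := Finset.sum_le_sum fun (L : Fin N) (_ : L ∈ Finset.univ) => hterm L
      rw [Fin.sum_univ_eq_sum_range (fun L => (1 / 4 : ℝ) ^ (L + 1)), hsum] at h1
      have : (0 : ℝ) < (1 / 4) ^ N := by positivity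
      push_cast at h1 ⊢
      linarith)
  let A : EuclideanSpace ℝ (Fin d) →ₗ[ℝ] EuclideanSpace ℝ (Fin m) :=
    (√m)⁻¹ • ((WithLp.linearEquiv 2 ℝ (Fin m → ℝ)).symm.toLinearMap ∘ₗ
      LinearMap.pi fun i => (innerₗ (EuclideanSpace ℝ (Fin d))) (g i))
  have hA : ∀ z, ‖A z‖ ^ 2 = (m : ℝ)⁻¹ * ∑ i, (inner ℝ z (g i)) ^ 2 := by
    intro z
    have : A z = (√m)⁻¹ • (WithLp.toLp 2 fun i => inner ℝ (g i) z) := rfl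
    rw [this, norm_smul, mul_pow, EuclideanSpace.norm_sq_eq]
    simp [real_inner_comm]
  refine ⟨A, ?_, ?_⟩
  · intro L h1 hLN θ
    obtain ⟨K, rfl⟩ : ∃ K, L = K + 1 := ⟨L - 1, by omega⟩
    have := lc ⟨⟨K, by omega⟩, θ⟩ g (hg (Sum.inl _))
    rw [hA, ← div_eq_inv_mul, le_div_iff₀ hm0]
    simp only at this
    linarith
  · intro i
    have := uc i g (hg (Sum.inr i))
    rw [hA, ← div_eq_inv_mul, div_le_iff₀ hm0]
    linarith

set_option maxHeartbeats 1000000 in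
lemma te_main {d : ℕ} (ε : ℝ) (hε : 0 < ε) (hε1 : ε < 1)
    (X : Finset (EuclideanSpace ℝ (Fin d))) (hX : 1 < X.card) (m : ℕ)
    (hm : 64 * Real.log X.card ≤ (ε / 40) ^ 2 * m) :
    ∃ f : EuclideanSpace ℝ (Fin d) → EuclideanSpace ℝ (Fin (m + 1)),
      ∀ x ∈ X, ∀ y : EuclideanSpace ℝ (Fin d),
        ‖x - y‖ ≤ ‖f x - f y‖ ∧ ‖f x - f y‖ ≤ (1 + ε) * ‖x - y‖ := by
  classical
  set e := ε / 40 with he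
  have he0 : 0 < e := by positivity
  let t : X × X → EuclideanSpace ℝ (Fin d) := fun p => ‖(p.1 : EuclideanSpace ℝ (Fin d)) - p.2‖⁻¹ • ((p.1 : EuclideanSpace ℝ (Fin d)) - p.2)
  have ht1 : ∀ p, ‖t p‖ ≤ 1 := by
    intro p
    simp only [t, norm_smul, norm_inv, norm_norm]
    exact inv_mul_le_one
  have htw : ∀ p : X × X, (p.1 : EuclideanSpace ℝ (Fin d)) - p.2 = ‖(p.1 : EuclideanSpace ℝ (Fin d)) - p.2‖ • t p := by
    intro p
    by_cases h : ‖(p.1 : EuclideanSpace ℝ (Fin d)) - p.2‖ = 0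
    · rw [h, zero_smul]; exact norm_eq_zero.1 h
    · simp only [t]; rw [smul_smul, mul_inv_cancel₀ h, one_smul]
  obtain ⟨A, H, U⟩ := te_random (n := X.card) (m := m) (ι := X × X) hX
    (by simp [sq]) t e he0 (by linarith) hm ⌈1 / e⌉₊
  have hmm := te_minimax t A (4 * e) (te_hull t ht1 A e he0 _ (Nat.le_ceil _) H U)
  -- consequences on differences
  have hup : ∀ a ∈ X, ∀ b ∈ X, ‖A (a - b)‖ ^ 2 ≤ (1 + e) * ‖a - b‖ ^ 2 := by
    intro a ha b hb
    have h1 := htw (⟨a, ha⟩, ⟨b, hb⟩)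
    have h2 := U (⟨a, ha⟩, ⟨b, hb⟩)
    simp only at h1
    set p : X × X := (⟨a, ha⟩, ⟨b, hb⟩)
    have h3 : ‖a - b‖ ^ 2 = ‖a - b‖ ^ 2 * ‖t p‖ ^ 2 := by
      conv_lhs => rw [h1, norm_smul, norm_norm, mul_pow]
    have h4 : ‖A (a - b)‖ ^ 2 = ‖a - b‖ ^ 2 * ‖A (t p)‖ ^ 2 := by
      conv_lhs => rw [h1, map_smul, norm_smul, norm_norm, mul_pow]
    rw [h4]
    nlinarith [sq_nonneg ‖a - b‖]
  have hlo : ∀ a ∈ X, ∀ b ∈ X, (1 - e) * ‖a - b‖ ^ 2 ≤ ‖A (a - b)‖ ^ 2 := by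
    intro a ha b hb
    have h1 := htw (⟨a, ha⟩, ⟨b, hb⟩)
    have h2 := H 1 le_rfl (Nat.one_le_iff_ne_zero.2 (by simpa using he0)) (fun _ => (⟨a, ha⟩, ⟨b, hb⟩))
    simp only at h1
    set p : X × X := (⟨a, ha⟩, ⟨b, hb⟩)
    simp at h2
    have h3 : ‖a - b‖ ^ 2 = ‖a - b‖ ^ 2 * ‖t p‖ ^ 2 := by
      conv_lhs => rw [h1, norm_smul, norm_norm, mul_pow]
    have h4 : ‖A (a - b)‖ ^ 2 = ‖a - b‖ ^ 2 * ‖A (t p)‖ ^ 2 := by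
      conv_lhs => rw [h1, map_smul, norm_smul, norm_norm, mul_pow]
    rw [h4]
    nlinarith [sq_nonneg ‖a - b‖]
  choose v hv1 hv2 using hmm
  have hin : ∀ u, ∀ a ∈ X, ∀ b ∈ X, inner ℝ u (a - b) - 4 * e * ‖u‖ * ‖a - b‖ ≤ inner ℝ (v u) (A (a - b)) := by
    intro u a ha b hb
    have h1 := htw (⟨a, ha⟩, ⟨b, hb⟩)
    have h2 := hv2 u (⟨a, ha⟩, ⟨b, hb⟩)
    simp only at h1
    set p : X × X := (⟨a, ha⟩, ⟨b, hb⟩)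
    have h3 : inner ℝ u (a - b) = ‖a - b‖ * inner ℝ u (t p) := by
      conv_lhs => rw [h1, real_inner_smul_right]
    have h4 : inner ℝ (v u) (A (a - b)) = ‖a - b‖ * inner ℝ (v u) (A (t p)) := by
      conv_lhs => rw [h1, map_smul, real_inner_smul_right]
    rw [h3, h4]
    nlinarith [norm_nonneg (a - b)]
  have hXne : X.Nonempty := Finset.card_pos.1 (by omega)
  choose k hkX hk using fun y => Finset.exists_min_image X (fun x => ‖x - y‖) hXne
  have hkself : ∀ x ∈ X, k x = x := by
    intro x hx
    have := hk x x hx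
    rw [sub_self, norm_zero] at this
    exact sub_eq_zero.1 (norm_le_zero_iff.1 this)
  set α := √(1 / (1 - ε / 2)) with hα
  have hα0 : 0 ≤ α := Real.sqrt_nonneg _
  have hα2 : α ^ 2 = 1 / (1 - ε / 2) := Real.sq_sqrt (by apply div_nonneg <;> linarith)
  let h : EuclideanSpace ℝ (Fin d) → EuclideanSpace ℝ (Fin m) := fun y => A (k y) + v (y - k y)
  let s : EuclideanSpace ℝ (Fin d) → ℝ := fun y => √(‖y - k y‖ ^ 2 - ‖v (y - k y)‖ ^ 2)
  let F : EuclideanSpace ℝ (Fin d) → EuclideanSpace ℝ (Fin (m + 1)) := fun y =>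
    WithLp.toLp 2 (Fin.cons (s y) (fun i => h y i))
  have hF : ∀ x y, ‖F x - F y‖ ^ 2 = (s x - s y) ^ 2 + ‖h x - h y‖ ^ 2 := by
    intro x y
    rw [EuclideanSpace.norm_sq_eq, EuclideanSpace.norm_sq_eq, Fin.sum_univ_succ]
    simp [F]
  have key : ∀ x ∈ X, ∀ y, (1 - ε / 2) * ‖x - y‖ ^ 2 ≤ ‖F x - F y‖ ^ 2 ∧
      ‖F x - F y‖ ^ 2 ≤ (1 + ε / 2) * ‖x - y‖ ^ 2 := by
    intro x hx y
    have hv0 : v 0 = 0 := by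
      have := hv1 0
      rw [norm_zero] at this
      exact norm_le_zero_iff.1 this
    have hsx : s x = 0 := by simp [s, hkself x hx, hv0]
    have hhx : h x = A x := by simp [h, hkself x hx, hv0]
    set u := y - k y with hu
    set w := x - k y with hw
    have hsy : s y ^ 2 = ‖u‖ ^ 2 - ‖v u‖ ^ 2 := by
      apply Real.sq_sqrt
      have := pow_le_pow_left₀ (norm_nonneg _) (hv1 u) 2
      linarith
    have e1 : ‖h x - h y‖ ^ 2 = ‖A w‖ ^ 2 - 2 * inner ℝ (v u) (A w) + ‖v u‖ ^ 2 := by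
      have : h x - h y = A w - v u := by
        rw [hhx, hw, map_sub]; simp only [h]; rw [← hu]; abel
      rw [this, norm_sub_sq_real, real_inner_comm]
    have e2 : ‖F x - F y‖ ^ 2 = ‖u‖ ^ 2 + ‖A w‖ ^ 2 - 2 * inner ℝ (v u) (A w) := by
      rw [hF, hsx, e1]
      linarith
    have e3 : ‖x - y‖ ^ 2 = ‖u‖ ^ 2 + ‖w‖ ^ 2 - 2 * inner ℝ u w := by
      have : x - y = w - u := by rw [hw, hu]; abel
      rw [this, norm_sub_sq_real, real_inner_comm]; ring
    have b1 := hin u x hx (k y) (hkX y)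
    have b2 := hin u (k y) (hkX y) x hx
    rw [← neg_sub x (k y), ← hw, map_neg, inner_neg_right, inner_neg_right, norm_neg] at b2
    rw [← hw] at b1
    have b3 := hup x hx (k y) (hkX y)
    have b4 := hlo x hx (k y) (hkX y)
    rw [← hw] at b3 b4
    set ρ := ‖x - y‖ with hρ
    have hρ0 : 0 ≤ ρ := norm_nonneg _
    have c1 : ‖u‖ ≤ ρ := by
      have := hk y x hx
      rwa [norm_sub_rev] at this
    have c2 : ‖w‖ ≤ 2 * ρ := by
      have hwu : w = (x - y) + u := by rw [hw, hu]; abel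
      have := norm_add_le (x - y) u
      rw [← hwu] at this
      linarith
    have c3 : ‖w‖ ^ 2 ≤ 4 * ρ ^ 2 := by nlinarith [norm_nonneg w]
    have c4 : ‖u‖ * ‖w‖ ≤ 2 * ρ ^ 2 := by nlinarith [norm_nonneg w, norm_nonneg u]
    have c5 := mul_le_mul_of_nonneg_left c3 he0.le
    have c6 := mul_le_mul_of_nonneg_left c4 he0.le
    have he' : ε / 2 = 20 * e := by rw [he]; ring
    rw [e2, he']
    constructor <;> linarith
  refine ⟨fun y => α • F y, fun x hx y => ?_⟩
  have hn : ‖α • F x - α • F y‖ ^ 2 = α ^ 2 * ‖F x - F y‖ ^ 2 := by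
    rw [← smul_sub, norm_smul, mul_pow, Real.norm_of_nonneg hα0]
  obtain ⟨k1, k2⟩ := key x hx y
  have hpos : 0 < 1 - ε / 2 := by linarith
  have hρ0 := sq_nonneg ‖x - y‖
  constructor
  · refine le_of_sq_le_sq ?_ (norm_nonneg _)
    rw [hn, hα2, one_div, ← div_eq_inv_mul, le_div_iff₀ hpos]
    linarith
  · refine le_of_sq_le_sq ?_ (by positivity)
    rw [hn, hα2, one_div, ← div_eq_inv_mul, div_le_iff₀ hpos]
    refine k2.trans ?_
    have : 1 + ε / 2 ≤ (1 + ε) ^ 2 * (1 - ε / 2) := by nlinarith [mul_pos hε hε]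
    nlinarith

/-- **Terminal embedding / JL with terminal distortion.**
For every `ε ∈ (0,1)` and finite `X ⊂ ℝ^d` of size `n > 1`, there exist
`m ≤ C·ε⁻²·log n` and a map `f : ℝ^d → ℝ^m` such that for all `x ∈ X` and
all `y ∈ ℝ^d`, `‖x - y‖ ≤ ‖f x - f y‖ ≤ (1+ε)·‖x - y‖`. -/
theorem terminal_embedding_exists :
    ∃ C : ℝ, 0 < C ∧
      ∀ (d : ℕ) (ε : ℝ), 0 < ε → ε < 1 →
        ∀ X : Finset (EuclideanSpace ℝ (Fin d)), 1 < X.card →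
          ∃ m : ℕ, (m : ℝ) ≤ C * ε⁻¹ ^ 2 * Real.log X.card ∧
            ∃ f : EuclideanSpace ℝ (Fin d) → EuclideanSpace ℝ (Fin m),
              ∀ x ∈ X, ∀ y : EuclideanSpace ℝ (Fin d),
                ‖x - y‖ ≤ ‖f x - f y‖ ∧ ‖f x - f y‖ ≤ (1 + ε) * ‖x - y‖ := by
  refine ⟨64 * 1600 + 4, by norm_num, fun d ε hε hε1 X hX => ?_⟩
  have hX2 : (2 : ℝ) ≤ X.card := by exact_mod_cast hX
  have hlog : 1 / 2 ≤ Real.log X.card := by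
    have h1 := Real.log_two_gt_d9
    have h2 := Real.log_le_log (by norm_num) hX2
    linarith
  have hi : 1 ≤ ε⁻¹ ^ 2 := one_le_pow₀ (one_le_inv_iff₀.2 ⟨hε, hε1.le⟩)
  set R := ε⁻¹ ^ 2 * Real.log X.card with hR
  have hR1 : 1 / 2 ≤ R := by nlinarith
  refine ⟨⌈64 * 1600 * R⌉₊ + 1, ?_, te_main ε hε hε1 X hX _ ?_⟩
  · have := Nat.ceil_lt_add_one (a := 64 * 1600 * R) (by positivity)
    push_cast
    rw [mul_assoc (64 * 1600 + 4 : ℝ), ← hR]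
    linarith
  · have := Nat.le_ceil (64 * 1600 * R)
    calc 64 * Real.log X.card = (ε / 40) ^ 2 * (64 * 1600 * R) := by
          rw [hR]; field_simp; norm_num
      _ ≤ _ := by gcongr
end

section
/- Let x₁, …, xₙ ∈ ℝ^d be distinct and let Y = { (xᵢ − xⱼ)/‖xᵢ − xⱼ‖₂ : i ≠ j }. Suppose Π ∈ ℝ^{m×d} provides ε-convex hull distortion for Y, with ε ≤ 1. Then for every u ∈ ℝ^d there exists a point f(u) ∈ ℝ^{m+1} such that, setting f(xᵢ) = (Π xᵢ, 0) ∈ ℝ^{m+1}, one has | ‖f(u) − f(xᵢ)‖₂² − ‖u − xᵢ‖₂² | ≤ 20·ε·‖u − xᵢ‖₂² for every i; in particular ‖f(u) − f(xᵢ)‖₂ = (1 ± O(ε))·‖u − xᵢ‖₂. -/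
/-- `Π` provides `ε`-convex hull distortion for `T ⊂ S^{d-1}` if
`|‖Πx‖ - ‖x‖| < ε` for every `x` in the convex hull of `T`. -/
def ProvidesConvexHullDistortion {m d : ℕ} (ε : ℝ) (M : Matrix (Fin m) (Fin d) ℝ)
    (T : Set (EuclideanSpace ℝ (Fin d))) : Prop :=
  ∀ x ∈ convexHull ℝ T, |‖Matrix.toEuclideanLin M x‖ - ‖x‖| < ε

/-- `(x, s) ∈ ℝ^{m+1}`: the vector whose first `m` coordinates are `x` and last is `s`. -/
noncomputable def appendCoord {m : ℕ} (x : EuclideanSpace ℝ (Fin m)) (s : ℝ) :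
    EuclideanSpace ℝ (Fin (m + 1)) :=
  (EuclideanSpace.equiv (Fin (m + 1)) ℝ).symm
    (Fin.snoc (EuclideanSpace.equiv (Fin m) ℝ x) s)

open scoped InnerProductSpace in
/-- Minimax step: existence of a short vector with prescribed approximate inner products. -/
theorem exists_short_vector {E F : Type*} [NormedAddCommGroup E] [InnerProductSpace ℝ E]
    [NormedAddCommGroup F] [InnerProductSpace ℝ F] [FiniteDimensional ℝ F] {n : ℕ}
    (A : E →ₗ[ℝ] F) (w : Fin n → E) (v : E) (ε : ℝ) (hε : 0 ≤ ε)
    (h : ∀ l : Fin n → ℝ, ‖∑ i, l i • w i‖ ≤ ‖A (∑ i, l i • w i)‖ + ε * ∑ i, |l i| * ‖w i‖) :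
    ∃ z : F, ‖z‖ ≤ ‖v‖ ∧ ∀ i, |inner ℝ z (A (w i)) - inner ℝ v (w i)| ≤ ε * ‖v‖ * ‖w i‖ := by
  classical
  let g : F →ₗ[ℝ] (Fin n → ℝ) := LinearMap.pi fun i => (innerₗ F (A (w i)))
  have hg : ∀ z i, g z i = inner ℝ (A (w i)) z := fun z i => rfl
  let c : Fin n → ℝ := fun i => inner ℝ v (w i)
  let b : Fin n → ℝ := fun i => ε * ‖v‖ * ‖w i‖
  by_cases hd : Disjoint (g '' Metric.closedBall 0 ‖v‖) (Set.Icc (c - b) (c + b))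
  · exfalso
    have : ProperSpace F := FiniteDimensional.proper ℝ F
    obtain ⟨f, s, t, h1, h2, h3⟩ := geometric_hahn_banach_compact_closed
      ((convex_closedBall (0 : F) ‖v‖).linear_image g)
      ((isCompact_closedBall (0 : F) ‖v‖).image g.continuous_of_finiteDimensional)
      (convex_Icc (𝕜 := ℝ) (c - b) (c + b)) isClosed_Icc hd
    let l : Fin n → ℝ := fun i => f (Pi.single i 1)
    have hf : ∀ z, f z = ∑ i, l i * z i := by
      intro z
      have := LinearMap.pi_apply_eq_sum_univ (f : (Fin n → ℝ) →ₗ[ℝ] ℝ) z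
      simp only [ContinuousLinearMap.coe_coe, smul_eq_mul] at this
      rw [this]
      refine Finset.sum_congr rfl fun i _ => ?_
      rw [mul_comm]
      congr 2
      ext j
      simp [Pi.single_apply, eq_comm]
    set y := ∑ i, l i • w i with hy
    have hb : ∀ i, 0 ≤ b i := fun i => by positivity
    have e1 : t < inner ℝ v y - ε * ‖v‖ * ∑ i, |l i| * ‖w i‖ := by
      have := h3 (fun i => c i - SignType.sign (l i) * b i) (by
        constructor <;> intro i <;> have := hb i <;>
          rcases lt_trichotomy (l i) 0 with h | h | h <;> simp [h] <;> linarith)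
      rw [hf] at this
      convert this using 1
      rw [hy, inner_sum, Finset.mul_sum, ← Finset.sum_sub_distrib]
      refine Finset.sum_congr rfl fun i _ => ?_
      rw [inner_smul_right, mul_sub, ← mul_assoc (l i), self_mul_sign]
      simp only [c, b]; ring
    have e2 : ‖v‖ * ‖A y‖ < s := by
      have key : ∀ z, f (g z) = inner ℝ (A y) z := by
        intro z
        rw [hf, hy, map_sum, sum_inner]
        refine Finset.sum_congr rfl fun i _ => ?_
        rw [map_smul, real_inner_smul_left, hg]
      by_cases hA : A y = 0
      · have := h1 _ ⟨0, by simp, rfl⟩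
        rw [key] at this
        simpa [hA] using this
      · have hA' : ‖A y‖ ≠ 0 := norm_ne_zero_iff.2 hA
        have := h1 _ ⟨(‖v‖ * ‖A y‖⁻¹) • A y, by
          simp [norm_smul, hA'], rfl⟩
        rw [key, real_inner_smul_right, real_inner_self_eq_norm_sq] at this
        convert this using 1
        field_simp
    have e3 := real_inner_le_norm v y
    have e4 := mul_le_mul_of_nonneg_left (h l) (norm_nonneg v)
    rw [← hy] at e4
    nlinarith
  · obtain ⟨_, ⟨z, hz, rfl⟩, hz2⟩ := Set.not_disjoint_iff.1 hd
    refine ⟨z, by simpa using hz, fun i => ?_⟩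
    have a1 := hz2.1 i
    have a2 := hz2.2 i
    simp only [Pi.sub_apply, Pi.add_apply, hg, c, b] at a1 a2
    rw [real_inner_comm, abs_le]
    constructor <;> linarith

theorem appendCoord_sub_norm_sq {m : ℕ} (a b : EuclideanSpace ℝ (Fin m)) (s : ℝ) :
    ‖appendCoord a s - appendCoord b 0‖ ^ 2 = ‖a - b‖ ^ 2 + s ^ 2 := by
  rw [EuclideanSpace.norm_sq_eq, EuclideanSpace.norm_sq_eq, Fin.sum_univ_castSucc]
  simp [appendCoord]

/-- **Lemma (ReductionLemma2).** If `Π` provides `ε`-convex hull distortion for the set of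
normalized differences `Y = {(xᵢ-xⱼ)/‖xᵢ-xⱼ‖ : i ≠ j}`, then for every `u ∈ ℝ^d` there is a
point `fu ∈ ℝ^{m+1}` such that, with `f(xᵢ) = (Πxᵢ, 0)`, one has
`|‖fu - f(xᵢ)‖² - ‖u - xᵢ‖²| ≤ 20·ε·‖u - xᵢ‖²` for all `i`. -/
theorem reduction_lemma_two {m d n : ℕ} (ε : ℝ) (hε₀ : 0 < ε) (hε₁ : ε ≤ 1)
    (x : Fin n → EuclideanSpace ℝ (Fin d)) (hx : Function.Injective x)
    (M : Matrix (Fin m) (Fin d) ℝ)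
    (hM : ProvidesConvexHullDistortion ε M
      {y | ∃ i j, i ≠ j ∧ y = ‖x i - x j‖⁻¹ • (x i - x j)}) :
    ∀ u : EuclideanSpace ℝ (Fin d), ∃ fu : EuclideanSpace ℝ (Fin (m + 1)),
      ∀ i, |‖fu - appendCoord (Matrix.toEuclideanLin M (x i)) 0‖ ^ 2 - ‖u - x i‖ ^ 2|
          ≤ 20 * ε * ‖u - x i‖ ^ 2 := by
  intro u
  rcases isEmpty_or_nonempty (Fin n) with hn | hn
  · exact ⟨0, fun i => isEmptyElim i⟩
  obtain ⟨k, hk⟩ := Finite.exists_min fun i => ‖u - x i‖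
  set A := Matrix.toEuclideanLin M with hAdef
  set Y := {y | ∃ i j, i ≠ j ∧ y = ‖x i - x j‖⁻¹ • (x i - x j)} with hY
  have hYn : ∀ y ∈ Y, -y ∈ Y := by
    rintro y ⟨i, j, hij, rfl⟩
    refine ⟨j, i, hij.symm, ?_⟩
    rw [norm_sub_rev, ← smul_neg, neg_sub]
  -- each scaled difference is a nonnegative multiple of an element of `Y`
  have hscale : ∀ (a : ℝ) (i : Fin n), Y.Nonempty →
      ∃ y ∈ Y, a • (x i - x k) = (|a| * ‖x i - x k‖) • y := by
    intro a i hne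
    by_cases hik : i = k
    · obtain ⟨y, hy⟩ := hne
      exact ⟨y, hy, by simp [hik]⟩
    · have hmem : ‖x i - x k‖⁻¹ • (x i - x k) ∈ Y := ⟨i, k, hik, rfl⟩
      have hne0 : ‖x i - x k‖ ≠ 0 := norm_ne_zero_iff.2 (sub_ne_zero.2 fun e => hik (hx e))
      rcases le_total 0 a with ha | ha
      · refine ⟨_, hmem, ?_⟩
        rw [smul_smul, abs_of_nonneg ha, mul_assoc, mul_inv_cancel₀ hne0, mul_one]
      · refine ⟨_, hYn _ hmem, ?_⟩
        rw [smul_neg, smul_smul, abs_of_nonpos ha, mul_assoc, mul_inv_cancel₀ hne0, mul_one,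
          neg_smul, neg_neg]
  have hdist : ∀ l : Fin n → ℝ,
      |‖A (∑ i, l i • (x i - x k))‖ - ‖∑ i, l i • (x i - x k)‖|
        ≤ ε * ∑ i, |l i| * ‖x i - x k‖ := by
    intro l
    set S := ∑ i, |l i| * ‖x i - x k‖ with hS
    have hS0 : 0 ≤ S := Finset.sum_nonneg fun i _ => by positivity
    rcases hS0.eq_or_lt with h0 | hpos
    · have hz : ∑ i, l i • (x i - x k) = 0 := by
        refine Finset.sum_eq_zero fun i _ => ?_
        have := (Finset.sum_eq_zero_iff_of_nonneg (fun i _ => by positivity)).1 h0.symm i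
          (Finset.mem_univ i)
        rwa [← norm_eq_zero, norm_smul, Real.norm_eq_abs]
      rw [hz, ← h0]; simp
    · have hne : Y.Nonempty := by
        obtain ⟨i, -, hi⟩ := Finset.exists_ne_zero_of_sum_ne_zero hpos.ne'
        have hik : i ≠ k := by rintro rfl; simp at hi
        exact ⟨_, i, k, hik, rfl⟩
      choose y hyY hy using fun i => hscale (l i) i hne
      have hmem : S⁻¹ • ∑ i, l i • (x i - x k) ∈ convexHull ℝ Y := by
        rw [Finset.smul_sum]
        simp_rw [hy, smul_smul]
        refine (convex_convexHull ℝ Y).sum_mem (fun i _ => by positivity) ?_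
          (fun i _ => subset_convexHull ℝ Y (hyY i))
        rw [← Finset.mul_sum, ← hS, inv_mul_cancel₀ hpos.ne']
      have := (hM _ hmem).le
      rw [map_smul, norm_smul, norm_smul, ← mul_sub, abs_mul, abs_norm, norm_inv,
        Real.norm_of_nonneg hS0, inv_mul_le_iff₀ hpos] at this
      linarith
  obtain ⟨z, hz, hzi⟩ := exists_short_vector A (fun i => x i - x k) (u - x k) ε hε₀.le
    (fun l => by have := (abs_le.1 (hdist l)).1; linarith)
  refine ⟨appendCoord (A (x k) + z) √(‖u - x k‖ ^ 2 - ‖z‖ ^ 2), fun i => ?_⟩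
  rw [appendCoord_sub_norm_sq, Real.sq_sqrt (by
    have := norm_nonneg z
    nlinarith)]
  have hw := hdist (Pi.single i 1)
  simp only [Pi.single_apply, ite_smul, one_smul, zero_smul, Finset.sum_ite_eq',
    Finset.mem_univ, if_true, apply_ite abs, abs_one, abs_zero, ite_mul, one_mul, zero_mul] at hw
  have hzi := hzi i
  have hki := hk i
  have tri : ‖x i - x k‖ ≤ 2 * ‖u - x i‖ := by
    have e : x i - x k = (u - x k) - (u - x i) := by abel
    have := norm_sub_le (u - x k) (u - x i)
    rw [← e] at this
    linarith
  have E1 : ‖A (x k) + z - A (x i)‖ ^ 2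
      = ‖z‖ ^ 2 - 2 * inner ℝ z (A (x i - x k)) + ‖A (x i - x k)‖ ^ 2 := by
    rw [← norm_sub_sq_real, map_sub]; congr 2; abel
  have E2 : ‖u - x i‖ ^ 2
      = ‖u - x k‖ ^ 2 - 2 * inner ℝ (u - x k) (x i - x k) + ‖x i - x k‖ ^ 2 := by
    rw [← norm_sub_sq_real]; congr 2; abel
  have hr := norm_nonneg (u - x k)
  have hW := norm_nonneg (x i - x k)
  have hP := norm_nonneg (A (x i - x k))
  have hρ := norm_nonneg (u - x i)
  have D1 : |‖A (x i - x k)‖ ^ 2 - ‖x i - x k‖ ^ 2| ≤ 12 * ε * ‖u - x i‖ ^ 2 := by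
    generalize ‖A (x i - x k)‖ = p at *
    generalize ‖x i - x k‖ = q at *
    generalize ‖u - x i‖ = ρ at *
    have hp : p + q ≤ 3 * q := by
      have := (abs_le.1 hw).2
      nlinarith
    calc |p ^ 2 - q ^ 2| = |p - q| * (p + q) := by
          rw [← abs_of_nonneg (add_nonneg hP hW), ← abs_mul]; congr 1;
          ring
      _ ≤ (ε * q) * (3 * q) := by gcongr
      _ ≤ (ε * (2 * ρ)) * (3 * (2 * ρ)) := by gcongr
      _ = 12 * ε * ρ ^ 2 := by ring
  have D2 : ε * ‖u - x k‖ * ‖x i - x k‖ ≤ 2 * ε * ‖u - x i‖ ^ 2 := by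
    calc ε * ‖u - x k‖ * ‖x i - x k‖ ≤ ε * ‖u - x i‖ * (2 * ‖u - x i‖) := by gcongr
      _ = _ := by ring
  have D3 : 0 ≤ ε * ‖u - x i‖ ^ 2 := by positivity
  have d1 := abs_le.1 D1
  have d2 := abs_le.1 hzi
  rw [E1, abs_le]
  constructor <;> linarith [d1.1, d1.2, d2.1, d2.2]
end

section
/- There exist universal constants c, C > 0 with the following property. Let ε, δ ∈ (0,1), let x₁, …, xₙ ∈ ℝ^d be unit vectors, let T = conv{x₁, …, xₙ}, and for k ≥ 0 let T_k = { t ∈ T : ‖t‖₂ ≤ 2^{−k} }. Let m ≥ c·ε⁻²·log(n·log(2/ε)/δ), and let Π ∈ ℝ^{m×d} be a random matrix whose entries are i.i.d. Gaussian with mean 0 and variance 1/m. Then for every k ≥ 0, the probability that sup_{t ∈ T_k} | ‖Π t‖₂² − ‖t‖₂² | ≥ C·(ε² + ε·2^{−k}) is at most δ/(n·log(2/ε)). -/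
open MeasureTheory ProbabilityTheory
open scoped NNReal

lemma aux_one_sub_exp (x : ℝ) (h1 : -(1/2) ≤ x) (h2 : x ≤ 1/2) :
    1 ≤ (1 - x) * Real.exp (x + x^2) := by
  rcases le_total x 0 with h | h
  · have := Real.add_one_le_exp (x + x^2)
    calc 1 ≤ (1 - x) * (x + x^2 + 1) := by nlinarith [mul_nonneg (neg_nonneg.2 h) (sq_nonneg x)]
      _ ≤ _ := by gcongr; linarith
  · have := Real.quadratic_le_exp_of_nonneg (x := x + x^2) (by positivity)
    calc 1 ≤ (1 - x) * (1 + (x + x^2) + (x + x^2)^2 / 2) := by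
          have : 0 ≤ (1-x^2)*(1+x) - 2*x := by nlinarith
          nlinarith [mul_nonneg (sq_nonneg x) this]
      _ ≤ _ := by gcongr; linarith

lemma aux_gauss_int (v : ℝ≥0) (hv : v ≠ 0) (b : ℝ) (hb : 2 * b * v < 1) :
    ∫ x, Real.exp (b * x^2) ∂(gaussianReal 0 v) = (√(1 - 2*b*v))⁻¹ := by
  have hv' : (0:ℝ) < v := by positivity
  rw [integral_gaussianReal_eq_integral_smul hv]
  have : ∀ x : ℝ, gaussianPDFReal 0 v x • Real.exp (b * x^2)
      = (√(2 * Real.pi * v))⁻¹ * Real.exp (-((1 - 2*b*v)/(2*v)) * x^2) := by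
    intro x
    rw [gaussianPDFReal, smul_eq_mul, mul_assoc, ← Real.exp_add]
    congr 2
    field_simp
    ring
  simp_rw [this]
  rw [integral_const_mul, integral_gaussian, ← Real.sqrt_inv, ← Real.sqrt_inv, ← Real.sqrt_mul (by positivity)]
  congr 1
  have : 0 < 1 - 2*b*v := by linarith
  field_simp

lemma aux_law (d : ℕ) (v : ℝ≥0) (y : EuclideanSpace ℝ (Fin d)) (hy : ‖y‖ = 1) :
    (Measure.pi fun _ : Fin d => gaussianReal 0 v).map (fun w => ∑ j, w j * y j)
      = gaussianReal 0 v := by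
  have hm : Measurable (fun w : Fin d → ℝ => ∑ j, w j * y j) := by fun_prop
  have := Measure.isProbabilityMeasure_map (μ := (Measure.pi fun _ : Fin d => gaussianReal 0 v)) hm.aemeasurable
  refine Measure.ext_of_charFun (funext fun t => ?_)
  rw [charFun_apply_real, integral_map hm.aemeasurable (by fun_prop)]
  have : ∀ w : Fin d → ℝ, Complex.exp (t * ((∑ j, w j * y j : ℝ) : ℂ) * Complex.I)
      = ∏ j, (fun (j : Fin d) (z : ℝ) => Complex.exp (((t * y j : ℝ) : ℂ) * z * Complex.I)) j (w j) := by
    intro w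
    rw [← Complex.exp_sum]
    congr 1
    push_cast
    rw [Finset.mul_sum, Finset.sum_mul]
    exact Finset.sum_congr rfl fun j _ => by ring
  rw [integral_congr_ae (Filter.Eventually.of_forall this),
    integral_fintype_prod_eq_prod (fun (j : Fin d) (z : ℝ) =>
      Complex.exp (((t * y j : ℝ) : ℂ) * z * Complex.I))]
  simp_rw [← charFun_apply_real, charFun_gaussianReal, ← Complex.exp_sum]
  congr 1
  have h2 : ∑ j, (y j)^2 = 1 := by
    rw [← EuclideanSpace.real_norm_sq_eq, hy]; norm_num
  have h3 : ∑ j, ((y j : ℝ) : ℂ)^2 = 1 := by exact_mod_cast h2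
  simp only [Complex.ofReal_zero, mul_zero, zero_mul, zero_sub, Complex.ofReal_mul, mul_pow]
  rw [Finset.sum_neg_distrib, ← Finset.sum_div, ← Finset.mul_sum, ← Finset.mul_sum, h3, mul_one]

lemma aux_norm {m d : ℕ} (ω : Fin m → Fin d → ℝ) (y : EuclideanSpace ℝ (Fin d)) :
    ‖Matrix.toEuclideanLin (Matrix.of ω) y‖ ^ 2 = ∑ i, (∑ j, ω i j * y j)^2 := by
  rw [EuclideanSpace.real_norm_sq_eq]
  simp [Matrix.mulVec, dotProduct]

lemma aux_mgf {m d : ℕ} (hm : 0 < m) (y : EuclideanSpace ℝ (Fin d)) (hy : ‖y‖ = 1) (τ : ℝ)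
    (h1 : -(1/4) ≤ τ) (h2 : τ ≤ 1/4) :
    mgf (fun ω => m * (‖Matrix.toEuclideanLin (Matrix.of ω) y‖ ^ 2 - 1))
      (Measure.pi fun _ : Fin m => Measure.pi fun _ : Fin d =>
                  gaussianReal 0 (1 / m : ℝ≥0)) τ ≤ Real.exp (2 * τ^2 * m) ∧
    Integrable (fun ω => Real.exp (τ * (m * (‖Matrix.toEuclideanLin (Matrix.of ω) y‖ ^ 2 - 1))))
      (Measure.pi fun _ : Fin m => Measure.pi fun _ : Fin d =>
                  gaussianReal 0 (1 / m : ℝ≥0)) := by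
  have hm' : (0:ℝ) < m := by exact_mod_cast hm
  have e1 : ∀ ω : Fin m → Fin d → ℝ,
     Real.exp (τ * (m * (‖Matrix.toEuclideanLin (Matrix.of ω) y‖ ^ 2 - 1)))
      = ∏ i, (fun z : Fin d → ℝ => Real.exp (-τ) * Real.exp (τ * m * (∑ j, z j * y j)^2)) (ω i) := by
    intro ω
    rw [aux_norm]
    simp only [← Real.exp_add]
    rw [← Real.exp_sum, Finset.sum_add_distrib, ← Finset.mul_sum]
    congr 1
    simp
    ring
  have hv : (1 / m : ℝ≥0) ≠ 0 := by positivity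
  have e2 : ∫ z : Fin d → ℝ, Real.exp (-τ) * Real.exp (τ * m * (∑ j, z j * y j)^2)
      ∂(Measure.pi fun _ : Fin d => gaussianReal 0 (1 / m : ℝ≥0)) = Real.exp (-τ) * (√(1 - 2*τ))⁻¹ := by
    rw [integral_const_mul]
    congr 1
    have := aux_gauss_int (1/m : ℝ≥0) hv (τ * m) (by push_cast; field_simp; linarith)
    rw [← aux_law d _ y hy, integral_map (Measurable.aemeasurable (by fun_prop)) (by fun_prop)] at this
    rw [this]
    congr 3
    push_cast
    field_simp
  have e3 : ∫ ω, Real.exp (τ * (m * (‖Matrix.toEuclideanLin (Matrix.of ω) y‖ ^ 2 - 1)))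
      ∂(Measure.pi fun _ : Fin m => Measure.pi fun _ : Fin d =>
                  gaussianReal 0 (1 / m : ℝ≥0)) = (Real.exp (-τ) * (√(1 - 2*τ))⁻¹)^m := by
    rw [integral_congr_ae (Filter.Eventually.of_forall e1),
      integral_fintype_prod_eq_pow (fun z : Fin d → ℝ =>
        Real.exp (-τ) * Real.exp (τ * m * (∑ j, z j * y j)^2)), e2, Fintype.card_fin]
  have hs : 0 < √(1 - 2*τ) := Real.sqrt_pos.2 (by linarith)
  constructor
  · rw [mgf, e3, mul_comm _ (m:ℝ), Real.exp_nat_mul]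
    gcongr
    have := aux_one_sub_exp (2*τ) (by linarith) (by linarith)
    have h5 : Real.exp (-τ) ≤ Real.exp (2*τ^2) * √(1 - 2*τ) := by
      have : 1 ≤ √(1 - 2*τ) * Real.exp (τ + 2*τ^2) := by
        have h6 := Real.sqrt_le_sqrt this
        rw [Real.sqrt_one, Real.sqrt_mul (by linarith), ← Real.exp_half] at h6
        convert h6 using 3
        ring
      calc Real.exp (-τ) = Real.exp (-τ) * 1 := by ring
        _ ≤ Real.exp (-τ) * (√(1 - 2*τ) * Real.exp (τ + 2*τ^2)) := by gcongr
        _ = (Real.exp (-τ) * Real.exp (τ + 2*τ^2)) * √(1 - 2*τ) := by ring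
        _ = _ := by rw [← Real.exp_add]; congr 2; ring
    rw [← div_eq_mul_inv, div_le_iff₀ hs]
    exact h5
  · apply Integrable.of_integral_ne_zero
    rw [e3]
    positivity

lemma aux_tail {m d : ℕ} (hm : 0 < m) (y : EuclideanSpace ℝ (Fin d)) (hy : ‖y‖ = 1) (u : ℝ)
    (hu : 0 < u) :
    (Measure.pi fun _ : Fin m => Measure.pi fun _ : Fin d =>
                  gaussianReal 0 (1 / m : ℝ≥0)).real
     {ω | u + u^2 ≤ |‖Matrix.toEuclideanLin (Matrix.of ω) y‖ ^ 2 - 1|} ≤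
       2 * Real.exp (-(m * u^2/8)) := by
  have hm' : (0:ℝ) < m := by exact_mod_cast hm
  set μ := (Measure.pi fun _ : Fin m => Measure.pi fun _ : Fin d =>
                  gaussianReal 0 (1 / m : ℝ≥0)) with hμ
  obtain ⟨τ, ht0, ht1, ht2⟩ : ∃ τ : ℝ, 0 ≤ τ ∧ τ ≤ 1/4 ∧ 2 * τ^2 - τ * (u+u^2) ≤ -(u^2/8) := by
    rcases le_total u 1 with h | h
    · exact ⟨u/4, by positivity, by linarith, by nlinarith [pow_pos hu 3]⟩
    · exact ⟨1/4, by norm_num, by norm_num, by nlinarith⟩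
  have key : Real.exp (-τ * (m * (u+u^2))) * Real.exp (2 * τ^2 * m) ≤ Real.exp (-(m * u^2/8)) := by
    rw [← Real.exp_add]
    gcongr
    nlinarith
  obtain ⟨a1, a2⟩ := aux_mgf hm y hy τ (by linarith) ht1
  obtain ⟨b1, b2⟩ := aux_mgf hm y hy (-τ) (by linarith) (by linarith)
  have c1 := measure_ge_le_exp_mul_mgf (μ := μ) (X := fun ω => m * (‖Matrix.toEuclideanLin (Matrix.of ω) y‖ ^ 2 - 1)) (t := τ) (m * (u+u^2)) ht0 a2
  have c2 := measure_le_le_exp_mul_mgf (μ := μ) (X := fun ω => m * (‖Matrix.toEuclideanLin (Matrix.of ω) y‖ ^ 2 - 1)) (t := -τ) (-(m * (u+u^2))) (by linarith) b2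
  have d1 := c1.trans ((mul_le_mul_of_nonneg_left a1 (Real.exp_pos _).le).trans key)
  have d2 := c2.trans ((mul_le_mul_of_nonneg_left b1 (Real.exp_pos _).le).trans (show _ ≤ Real.exp (-(m * u^2/8)) by
    rw [neg_sq]
    rw [show - -τ * -(m * (u+u^2)) = -τ * (m * (u+u^2)) by ring]
    exact key))
  calc _ ≤ μ.real ({ω | m * (u+u^2) ≤ m * (‖Matrix.toEuclideanLin (Matrix.of ω) y‖ ^ 2 - 1)} ∪
        {ω | m * (‖Matrix.toEuclideanLin (Matrix.of ω) y‖ ^ 2 - 1) ≤ -(m * (u+u^2))}) := by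
        refine measureReal_mono ?_ (measure_ne_top _ _)
        intro ω hω
        rcases le_abs.1 (Set.mem_ofPred_eq ▸ hω) with h | h
        · left; exact mul_le_mul_of_nonneg_left h hm'.le
        · right
          have := mul_le_mul_of_nonneg_left h hm'.le
          simp only [Set.mem_ofPred_eq]
          linarith
    _ ≤ _ := measureReal_union_le _ _
    _ ≤ _ := by linarith

lemma aux_maurey {ι E F : Type*} [Fintype ι] [NormedAddCommGroup E] [InnerProductSpace ℝ E]
    [NormedAddCommGroup F] [InnerProductSpace ℝ F] (L : E →ₗ[ℝ] F) (w : ι → ℝ) (hw : ∑ i, w i = 1)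
    (x : ι → E) (r : ℕ) : ∀ z : E,
    ∑ f : Fin r → ι, (∏ l, w (f l)) * ‖L (z + ∑ l, x (f l))‖^2 =
      ‖L z‖^2 + 2 * r * inner ℝ (L z) (L (∑ i, w i • x i)) + r * ∑ i, w i * ‖L (x i)‖^2
        + r * (r - 1) * ‖L (∑ i, w i • x i)‖^2 := by
  induction r with
  | zero => intro z; simp
  | succ r ih =>
    intro z
    rw [← (Fin.consEquiv (fun _ : Fin (r+1) => ι)).sum_comp, Fintype.sum_prod_type]
    simp only [Fin.consEquiv, Equiv.coe_fn_mk, Fin.prod_univ_succ, Fin.sum_univ_succ, Fin.cons_zero,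
      Fin.cons_succ, mul_assoc, ← Finset.mul_sum, ← add_assoc]
    simp_rw [ih]
    set t := ∑ i, w i • x i with ht
    set q := ∑ i, w i * ‖L (x i)‖^2 with hq
    have h1 : ∀ a : F, ∑ i, w i * inner ℝ a (L (x i)) = inner ℝ a (L t) := by
      intro a
      simp [ht, map_sum, inner_sum, inner_smul_right]
    have h2 : ∀ i, w i * (‖L (z + x i)‖^2 + 2 * r * inner ℝ (L (z + x i)) (L t) + r * q
        + r * (r-1) * ‖L t‖^2) = w i * (‖L z‖^2 + 2 * r * inner ℝ (L z) (L t) + r * q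
        + r * (r-1) * ‖L t‖^2) + 2 * (w i * inner ℝ (L z) (L (x i))) + w i * ‖L (x i)‖^2
        + 2 * r * (w i * inner ℝ (L t) (L (x i))) := by
      intro i
      rw [map_add, norm_add_sq_real, inner_add_left, real_inner_comm (L t) (L (x i))]
      ring
    simp_rw [h2, Finset.sum_add_distrib, ← Finset.sum_mul, ← Finset.mul_sum, h1, hw, ← hq]
    rw [real_inner_self_eq_norm_sq]
    push_cast
    ring

lemma aux_det {E F : Type*} [NormedAddCommGroup E] [InnerProductSpace ℝ E]
    [NormedAddCommGroup F] [InnerProductSpace ℝ F] (L : E →ₗ[ℝ] F) {n : ℕ} (x : Fin n → E)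
    (hx : ∀ i, ‖x i‖ = 1) (r : ℕ) (hr : 2 ≤ r) (v : ℝ)
    (hgood : ∀ f : Fin r → Fin n, |‖L (∑ l, x (f l))‖^2 - ‖∑ l, x (f l)‖^2| ≤ v * ‖∑ l, x (f l)‖^2)
    (t : E) (ht : t ∈ convexHull ℝ (Set.range x)) :
    |‖L t‖^2 - ‖t‖^2| ≤ v * (‖t‖^2 + 4 / r) := by
  obtain ⟨ι, _, w, z, hw0, hw1, hz, rfl⟩ := mem_convexHull_iff_exists_fintype.1 ht
  choose g hg using hz
  have hr' : (2:ℝ) ≤ r := by exact_mod_cast hr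
  have hz1 : ∀ i, ‖z i‖ = 1 := fun i => by rw [← hg, hx]
  have hv1 : ∀ i, |‖L (z i)‖^2 - ‖z i‖^2| ≤ v := by
    intro i
    have := hgood (fun _ => g i)
    rw [hg] at this
    simp only [Finset.sum_const, Finset.card_univ, Fintype.card_fin, ← Nat.cast_smul_eq_nsmul ℝ, map_smul,
      norm_smul, mul_pow, ← mul_sub, abs_mul, hz1] at this ⊢
    simp at this ⊢
    rw [mul_comm v] at this
    exact le_of_mul_le_mul_left this (by positivity)
  have hv : 0 ≤ v := by
    obtain ⟨i⟩ : Nonempty ι := by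
      by_contra h
      rw [not_nonempty_iff] at h
      simp at hw1
    exact (abs_nonneg _).trans (hv1 i)
  have hf : ∀ f : Fin r → ι, |‖L (∑ l, z (f l))‖^2 - ‖∑ l, z (f l)‖^2| ≤ v * ‖∑ l, z (f l)‖^2 := by
    intro f
    have := hgood (fun l => g (f l))
    simpa only [hg] using this
  have A := aux_maurey L w hw1 z r 0
  have B := aux_maurey (LinearMap.id : E →ₗ[ℝ] E) w hw1 z r 0
  set t := ∑ i, w i • z i
  simp only [zero_add, map_zero, inner_zero_left, norm_zero, LinearMap.id_apply, mul_zero, ne_eq,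
    OfNat.ofNat_ne_zero, not_false_eq_true, zero_pow, hz1, one_pow, mul_one, hw1] at A B
  have C1 : |∑ f : Fin r → ι, (∏ l, w (f l)) * (‖L (∑ l, z (f l))‖^2 - ‖∑ l, z (f l)‖^2)|
      ≤ v * ∑ f : Fin r → ι, (∏ l, w (f l)) * ‖∑ l, z (f l)‖^2 := by
    rw [Finset.mul_sum]
    refine (Finset.abs_sum_le_sum_abs _ _).trans (Finset.sum_le_sum fun f _ => ?_)
    have hp : 0 ≤ ∏ l, w (f l) := Finset.prod_nonneg fun l _ => hw0 _
    rw [abs_mul, abs_of_nonneg hp]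
    nlinarith [mul_le_mul_of_nonneg_left (hf f) hp]
  have C2 : |∑ i, w i * (‖L (z i)‖^2 - 1)| ≤ v := by
    refine (Finset.abs_sum_le_sum_abs _ _).trans ?_
    calc _ ≤ ∑ i, w i * v := Finset.sum_le_sum fun i _ => by
          rw [abs_mul, abs_of_nonneg (hw0 i)]
          have := hv1 i
          rw [hz1, one_pow] at this
          exact mul_le_mul_of_nonneg_left this (hw0 i)
      _ = v := by rw [← Finset.sum_mul, hw1, one_mul]
  simp_rw [mul_sub, Finset.sum_sub_distrib] at C1 C2
  simp only [mul_one, hw1] at C2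
  rw [A, B] at C1
  set Q := ∑ i, w i * ‖L (z i)‖^2
  have e : (r:ℝ) * (r-1) * (‖L t‖^2 - ‖t‖^2) = ((r * Q + r * (r-1) * ‖L t‖^2) - (r + r*(r-1)*‖t‖^2))
     - r * (Q - 1) := by ring
  have hpos : 0 < (r:ℝ) * (r-1) := by nlinarith
  have D : (r:ℝ) * (r-1) * |‖L t‖^2 - ‖t‖^2| ≤ v * (r + r*(r-1)*‖t‖^2) + r * v := by
    rw [← abs_of_pos hpos, ← abs_mul, e, abs_of_pos hpos]
    refine (abs_sub _ _).trans ?_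
    rw [abs_mul (r:ℝ), abs_of_nonneg (by linarith : (0:ℝ) ≤ r)]
    gcongr
  have E' : v * (r + r*(r-1)*‖t‖^2) + r * v ≤ (r:ℝ) * (r-1) * (v * (‖t‖^2 + 4 / r)) := by
    have : (r:ℝ) * (r-1) * (v * (‖t‖^2 + 4 / r)) = v * (r * (r-1)*‖t‖^2) + v * (4 * (r-1)) := by
      field_simp
    rw [this]
    nlinarith
  exact le_of_mul_le_mul_left (D.trans E') hpos

lemma aux_tail' {m d : ℕ} (hm : 0 < m) (y : EuclideanSpace ℝ (Fin d)) (u : ℝ)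
    (hu : 0 < u) :
    (Measure.pi fun _ : Fin m => Measure.pi fun _ : Fin d =>
                  gaussianReal 0 (1 / m : ℝ≥0)).real
     {ω | (u + u^2) * ‖y‖^2 < |‖Matrix.toEuclideanLin (Matrix.of ω) y‖ ^ 2 - ‖y‖^2|} ≤
       2 * Real.exp (-(m * u^2/8)) := by
  rcases eq_or_ne y 0 with rfl | hy
  · simp
    positivity
  have hy' : 0 < ‖y‖ := norm_pos_iff.2 hy
  refine le_trans (measureReal_mono ?_ (measure_ne_top _ _))
    (aux_tail (d := d) hm (‖y‖⁻¹ • y) (by rw [norm_smul]; simp [hy'.ne']) u hu)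
  intro ω hω
  simp only [Set.mem_ofPred_eq] at hω ⊢
  rw [map_smul, norm_smul, mul_pow]
  simp only [norm_inv, norm_norm]
  have e : ‖Matrix.toEuclideanLin (Matrix.of ω) y‖ ^ 2 - ‖y‖^2 =
     (‖y‖⁻¹ ^ 2 * ‖Matrix.toEuclideanLin (Matrix.of ω) y‖ ^ 2 - 1) * ‖y‖^2 := by
    field_simp
  rw [e, abs_mul, abs_of_pos (by positivity : 0 < ‖y‖^2)] at hω
  exact (lt_of_mul_lt_mul_right hω (by positivity)).le

lemma aux_core {m d n : ℕ} (hm : 0 < m) (hn : 0 < n) (x : Fin n → EuclideanSpace ℝ (Fin d))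
    (hx : ∀ i, ‖x i‖ = 1) (s : ℝ) (hs : 0 < s) (hmn : 8 * Real.log n ≤ m * s^2) (k : ℕ) :
    (Measure.pi fun _ : Fin m => Measure.pi fun _ : Fin d =>
                  gaussianReal 0 (1 / m : ℝ≥0)).real
       {ω | ∃ t ∈ convexHull ℝ (Set.range x), ‖t‖ ≤ (1 / 2 : ℝ) ^ k ∧
                    13 * (s ^ 2 + s * (1 / 2 : ℝ) ^ k) ≤
                      |‖Matrix.toEuclideanLin (Matrix.of ω) t‖ ^ 2 - ‖t‖ ^ 2|}
      ≤ 2 * Real.exp (-(m * s^2 / 4)) := by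
  set μ := (Measure.pi fun _ : Fin m => Measure.pi fun _ : Fin d =>
                  gaussianReal 0 (1 / m : ℝ≥0)) with hμ
  have hn' : (0:ℝ) < n := by exact_mod_cast hn
  set a : ℝ := (1/2 : ℝ)^k with ha
  have ha0 : 0 < a := by positivity
  set r : ℕ := 2 * 4^k with hr
  have hr2 : 2 ≤ r := by
    have : 1 ≤ 4^k := Nat.one_le_pow _ _ (by norm_num)
    omega
  have h4 : (1:ℝ) ≤ 4^k := one_le_pow₀ (by norm_num)
  have h4a : (4:ℝ)^k * a^2 = 1 := by
    rw [ha, ← pow_mul, mul_comm k 2, pow_mul, ← mul_pow]; norm_num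
  have hra : (r:ℝ) * a^2 = 2 := by rw [hr]; push_cast; linarith
  set u := 2 * s / a with hu
  have hu0 : 0 < u := by positivity
  have hu2 : u^2 = 4 * s^2 * 4^k := by
    rw [hu, div_pow, div_eq_iff (by positivity)]
    linear_combination (-4 * s^2) * h4a
  set Y : (Fin r → Fin n) → EuclideanSpace ℝ (Fin d) := fun f => ∑ l, x (f l) with hY
  have step1 : μ.real {ω | ∃ t ∈ convexHull ℝ (Set.range x), ‖t‖ ≤ a ∧
                    13 * (s ^ 2 + s * a) ≤
                      |‖Matrix.toEuclideanLin (Matrix.of ω) t‖ ^ 2 - ‖t‖ ^ 2|}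
      ≤ μ.real (⋃ f : Fin r → Fin n, {ω | (u + u^2) * ‖Y f‖^2 <
          |‖Matrix.toEuclideanLin (Matrix.of ω) (Y f)‖ ^ 2 - ‖Y f‖^2|}) := by
    refine measureReal_mono ?_ (measure_ne_top _ _)
    rintro ω ⟨t, ht, hta, htd⟩
    by_contra hc
    simp only [Set.mem_iUnion, Set.mem_ofPred_eq, not_exists, not_lt] at hc
    have := aux_det (Matrix.toEuclideanLin (Matrix.of ω)) x hx r hr2 (u + u^2) hc t ht
    have h1 : ‖t‖^2 + 4 / r ≤ 3 * a^2 := by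
      have h2 : (4:ℝ) / r = 2 * a^2 := by
        rw [div_eq_iff (by positivity)]; linarith
      have : ‖t‖^2 ≤ a^2 := by gcongr
      linarith
    have h3 : (u + u^2) * (3 * a^2) = 6 * s * a + 12 * s^2 := by
      rw [hu]; field_simp; ring
    have h5 : (u + u^2) * (‖t‖^2 + 4 / r) ≤ (u + u^2) * (3 * a^2) := by gcongr
    nlinarith [mul_pos hs ha0, pow_pos hs 2]
  refine step1.trans ((measureReal_iUnion_fintype_le _).trans ?_)
  refine (Finset.sum_le_sum fun f _ => aux_tail' hm (Y f) u hu0).trans ?_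
  rw [Finset.sum_const, Finset.card_univ, Fintype.card_fun, Fintype.card_fin, Fintype.card_fin, nsmul_eq_mul]
  push_cast
  have e1 : (n:ℝ)^r = Real.exp (r * Real.log n) := by
    rw [Real.exp_nat_mul, Real.exp_log hn']
  rw [e1, mul_left_comm, ← Real.exp_add, hu2]
  gcongr
  rw [hr]
  push_cast
  have : (4:ℝ)^k * (8 * Real.log n) ≤ 4^k * (m * s^2) := by gcongr
  have : 1 * (m * s^2) ≤ 4^k * (m * s^2) := by gcongr
  linarith

theorem gaussian_matrix_levelset_bound :
    ∃ c C : ℝ, 0 < c ∧ 0 < C ∧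
      ∀ (d n : ℕ) (ε δ : ℝ), 0 < ε → ε < 1 → 0 < δ → δ < 1 →
        ∀ x : Fin n → EuclideanSpace ℝ (Fin d), (∀ i, ‖x i‖ = 1) →
          ∀ m : ℕ, c * ε⁻¹ ^ 2 * Real.log (n * Real.log (2 / ε) / δ) ≤ (m : ℝ) →
            ∀ k : ℕ,
              (Measure.pi fun _ : Fin m => Measure.pi fun _ : Fin d =>
                  gaussianReal 0 (1 / m : ℝ≥0))
                {ω | ∃ t ∈ convexHull ℝ (Set.range x), ‖t‖ ≤ (1 / 2 : ℝ) ^ k ∧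
                    C * (ε ^ 2 + ε * (1 / 2 : ℝ) ^ k) ≤
                      |‖Matrix.toEuclideanLin (Matrix.of ω) t‖ ^ 2 - ‖t‖ ^ 2|}
                ≤ ENNReal.ofReal (δ / (n * Real.log (2 / ε))) := by
  refine ⟨1, 13 * 36, by norm_num, by norm_num, ?_⟩
  intro d n ε δ hε hε1 hδ hδ1 x hx m hm k
  rcases Nat.eq_zero_or_pos n with rfl | hn
  · have : Set.range x = ∅ := Set.range_eq_empty x
    simp [this]
  have hn1 : (1:ℝ) ≤ n := by exact_mod_cast hn
  have hlog2 := Real.log_two_gt_d9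
  have hlog2' := Real.log_two_lt_d9
  have hl : Real.log 2 ≤ Real.log (2 / ε) := by
    apply Real.log_le_log (by norm_num)
    rw [le_div_iff₀ hε]; linarith
  set ℓ := Real.log (2 / ε) with hℓ
  have hℓ0 : 0 < ℓ := by linarith
  set N := n * ℓ / δ with hN
  have hN0 : 0 < N := by positivity
  have hinv : δ / (n * ℓ) = N⁻¹ := by rw [hN, inv_div]
  rw [hinv]
  rcases le_or_gt N 1 with hN1 | hN1
  · refine prob_le_one.trans ?_
    rw [ENNReal.one_le_ofReal]
    exact (one_le_inv₀ hN0).2 hN1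
  have hlogN : 0 < Real.log N := Real.log_pos hN1
  have hm1 : Real.log N ≤ m * ε^2 := by
    have := mul_le_mul_of_nonneg_right hm (by positivity : 0 ≤ ε^2)
    rw [one_mul, mul_right_comm, ← mul_pow, inv_mul_cancel₀ hε.ne', one_pow, one_mul] at this
    exact this
  have hmpos : 0 < m := by
    rcases Nat.eq_zero_or_pos m with rfl | h
    · simp at hm1; linarith
    · exact h
  have hm' : (1:ℝ) ≤ m := by exact_mod_cast hmpos
  have hNn : n * ℓ ≤ N := by
    rw [hN, le_div_iff₀ hδ]
    nlinarith [mul_pos (by linarith : (0:ℝ) < n) hℓ0]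
  have cond : 8 * Real.log n ≤ m * (6*ε)^2 ∧ Real.log 2 + Real.log N ≤ m * (6*ε)^2/4 := by
    rcases le_or_gt (1/4) (Real.log N) with h | h
    · have : Real.log n ≤ Real.log 2 + Real.log N := by
        rw [← Real.log_mul (by norm_num) hN0.ne']
        apply Real.log_le_log (by linarith)
        nlinarith
      constructor <;> nlinarith
    · have hN2 : N < 13/10 := by
        by_contra hc
        push Not at hc
        have h1 := Real.log_le_log (by norm_num) hc
        have h2 := Real.one_sub_inv_le_log_of_pos (x := (13/10 : ℝ)) (by norm_num)
        have h3 : (1/4:ℝ) ≤ Real.log (13/10) := by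
          rw [Real.le_log_iff_exp_le (by norm_num)]
          have := Real.exp_bound' (x := 1/4) (by norm_num) (by norm_num) (n := 4) (by norm_num)
          refine this.trans ?_
          norm_num [Finset.sum_range_succ, Nat.factorial]
        linarith
      have hn2 : n = 1 := by
        by_contra hc
        have : 2 ≤ n := by omega
        have : (2:ℝ) ≤ n := by exact_mod_cast this
        nlinarith
      have hε2 : 1/2 ≤ ε := by
        by_contra hc
        push Not at hc
        have h1 : Real.log (2*2) ≤ ℓ := by
          apply Real.log_le_log (by norm_num)
          rw [le_div_iff₀ hε]; linarith
        rw [Real.log_mul (by norm_num) (by norm_num)] at h1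
        nlinarith
      have : 1/4 ≤ m * ε^2 := by nlinarith
      subst hn2
      constructor
      · simp; positivity
      · nlinarith
  have core := aux_core hmpos hn x hx (6*ε) (by positivity) cond.1 k
  rw [← ofReal_measureReal]
  apply ENNReal.ofReal_le_ofReal
  calc _ ≤ _ := measureReal_mono ?_ (measure_ne_top _ _)
    _ ≤ _ := core
    _ ≤ N⁻¹ := by
      have : N⁻¹ = Real.exp (-Real.log N) := by rw [Real.exp_neg, Real.exp_log hN0]
      rw [this]
      calc 2 * Real.exp (-(m * (6*ε)^2/4)) = Real.exp (Real.log 2 + -(m * (6*ε)^2/4)) := by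
            rw [Real.exp_add, Real.exp_log (by norm_num)]
        _ ≤ _ := by gcongr; linarith [cond.2]
  rintro ω ⟨t, ht, hta, htd⟩
  refine ⟨t, ht, hta, le_trans ?_ htd⟩
  have : 0 < ε * (1/2 : ℝ)^k := by positivity
  nlinarith
end

section
/- There exists a universal constant c > 0 with the following property. Let ε ∈ (0,1) with 1 ≤ ε⁻² < n, let X = {x₁, …, xₙ} ⊂ S^{d−1} be a set of n unit vectors, and let m ≥ c·ε⁻²·log n. Let Π ∈ ℝ^{m×d} be a random matrix whose entries are i.i.d. Gaussian with mean 0 and variance 1/m. Then with probability at least 1 − 1/n, Π provides ε-convex hull distortion for X. -/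
open MeasureTheory ProbabilityTheory
open scoped NNReal

namespace CHD

/-- One step of the sampling identity. -/
lemma one_step {E : Type*} [NormedAddCommGroup E] [InnerProductSpace ℝ E] {n : ℕ}
    (w : Fin n → ℝ) (hw : ∑ i, w i = 1) (y : Fin n → E) (b : E) :
    ∑ i, w i * ‖b + y i‖ ^ 2 =
      ‖b + ∑ i, w i • y i‖ ^ 2 + (∑ i, w i * ‖y i‖ ^ 2 - ‖∑ i, w i • y i‖ ^ 2) := by
  simp only [norm_add_sq_real, inner_sum, inner_smul_right, mul_add, Finset.sum_add_distrib,
    ← Finset.sum_mul, hw, Finset.mul_sum]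
  have : ∀ i, w i * (2 * inner ℝ b (y i)) = 2 * (w i * inner ℝ b (y i)) := fun i => by ring
  simp only [this]
  ring

lemma sampling {E : Type*} [NormedAddCommGroup E] [InnerProductSpace ℝ E] {n : ℕ}
    (w : Fin n → ℝ) (hw : ∑ i, w i = 1) (y : Fin n → E) (k : ℕ) : ∀ (b : E),
    ∑ f : Fin k → Fin n, (∏ j, w (f j)) * ‖b + ∑ j, y (f j)‖ ^ 2 =
      ‖b + (k : ℝ) • ∑ i, w i • y i‖ ^ 2 +
        k * (∑ i, w i * ‖y i‖ ^ 2 - ‖∑ i, w i • y i‖ ^ 2) := by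
  induction k with
  | zero => intro b; simp
  | succ k ih =>
    intro b
    rw [← (Fin.consEquiv (fun _ : Fin (k + 1) => Fin n)).sum_comp, Fintype.sum_prod_type]
    simp only [Fin.consEquiv_apply, Fin.prod_univ_succ, Fin.sum_univ_succ, Fin.cons_zero,
      Fin.cons_succ, mul_assoc, ← Finset.mul_sum, ← add_assoc]
    simp only [ih, mul_add, Finset.sum_add_distrib, ← Finset.sum_mul, hw]
    have := one_step w hw y (b + (k : ℝ) • ∑ i, w i • y i)
    have e : ∀ i, b + y i + (k : ℝ) • ∑ i, w i • y i = b + (k : ℝ) • ∑ i, w i • y i + y i :=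
      fun i => by abel
    simp only [e, this]
    have e2 : b + ((k + 1 : ℕ) : ℝ) • ∑ i, w i • y i
      = b + (k : ℝ) • ∑ i, w i • y i + ∑ i, w i • y i := by
      push_cast; rw [add_smul, one_smul, add_assoc]
    rw [e2]; push_cast; ring

lemma sampling' {E : Type*} [NormedAddCommGroup E] [InnerProductSpace ℝ E] {n : ℕ}
    (w : Fin n → ℝ) (hw : ∑ i, w i = 1) (y : Fin n → E) (k : ℕ) :
    ∑ f : Fin k → Fin n, (∏ j, w (f j)) * ‖∑ j, y (f j)‖ ^ 2 =
      k * (k - 1) * ‖∑ i, w i • y i‖ ^ 2 + k * ∑ i, w i * ‖y i‖ ^ 2 := by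
  have := sampling w hw y k 0
  simp only [zero_add, norm_smul, mul_pow] at this
  rw [this]; simp; ring

set_option maxHeartbeats 1000000 in
/-- Deterministic step. -/
lemma det_step {E F : Type*} [NormedAddCommGroup E] [InnerProductSpace ℝ E]
    [NormedAddCommGroup F] [InnerProductSpace ℝ F] {n : ℕ} (L : E →ₗ[ℝ] F)
    (ε : ℝ) (hε : 0 < ε) (hε1 : ε < 1) (x : Fin n → E) (hx : ∀ i, ‖x i‖ = 1)
    (H : ∀ k : ℕ, 1 ≤ k → (k : ℝ) ≤ 3 * ε⁻¹ ^ 2 → ∀ f : Fin k → Fin n,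
      |‖L (∑ j, x (f j))‖ ^ 2 - ‖∑ j, x (f j)‖ ^ 2| ≤ ε * √k / 20 * ‖∑ j, x (f j)‖ ^ 2)
    (z : E) (hz : z ∈ convexHull ℝ (Set.range x)) : |‖L z‖ - ‖z‖| < ε := by
  obtain ⟨w, hw0, hw, rfl⟩ : ∃ w : Fin n → ℝ, (∀ i, 0 ≤ w i) ∧ ∑ i, w i = 1 ∧
      ∑ i, w i • x i = z := by
    rw [convexHull_range_eq_exists_affineCombination] at hz
    obtain ⟨s, w, h0, h1, rfl⟩ := hz
    refine ⟨fun i => if i ∈ s then w i else 0, ?_, ?_, ?_⟩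
    · intro i; dsimp only; split_ifs with h
      · exact h0 i h
      · exact le_rfl
    · simpa using h1
    · rw [Finset.affineCombination_eq_linear_combination _ _ _ h1]
      simp [ite_smul]
  set z := ∑ i, w i • x i with hzdef
  have hz1 : ‖z‖ ≤ 1 := by
    calc ‖z‖ ≤ ∑ i, ‖w i • x i‖ := norm_sum_le _ _
      _ = ∑ i, w i := by
        refine Finset.sum_congr rfl fun i _ => ?_
        rw [norm_smul, hx, mul_one, Real.norm_of_nonneg (hw0 i)]
      _ = 1 := hw
  set r := max ‖z‖ ε with hr
  have hrε : ε ≤ r := le_max_right _ _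
  have hrz : ‖z‖ ≤ r := le_max_left _ _
  have hr1 : r ≤ 1 := max_le hz1 hε1.le
  have hr0 : 0 < r := hε.trans_le hrε
  have hri : 1 ≤ r⁻¹ ^ 2 := one_le_pow₀ ((one_le_inv₀ hr0).2 hr1)
  have hrri : r ^ 2 * r⁻¹ ^ 2 = 1 := by
    rw [← mul_pow, mul_inv_cancel₀ hr0.ne', one_pow]
  obtain ⟨k, hk1, hk2, hk3⟩ : ∃ k : ℕ, r⁻¹ ^ 2 ≤ k ∧ (2 : ℝ) ≤ k ∧ (k : ℝ) ≤ 3 * r⁻¹ ^ 2 := by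
    refine ⟨⌈r⁻¹ ^ 2⌉₊ + 1, ?_, ?_, ?_⟩
    · push_cast; linarith [Nat.le_ceil (r⁻¹ ^ 2)]
    · push_cast; linarith [Nat.le_ceil (r⁻¹ ^ 2)]
    · push_cast; linarith [Nat.ceil_lt_add_one (by positivity : 0 ≤ r⁻¹ ^ 2)]
  have hir : r⁻¹ ^ 2 ≤ ε⁻¹ ^ 2 := by gcongr
  have Hk := H k (by exact_mod_cast (by linarith : (1 : ℝ) ≤ k)) (hk3.trans (by linarith))
  have H1 : ∀ i, |‖L (x i)‖ ^ 2 - 1| ≤ ε / 20 := by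
    intro i
    have := H 1 le_rfl (by push_cast; linarith) (fun _ => i)
    simpa [hx] using this
  have s1 := sampling' w hw x k
  have s2 := sampling' w hw (fun i => L (x i)) k
  have hLz : ∑ i, w i • L (x i) = L z := by simp [hzdef]
  rw [← hzdef] at s1
  rw [hLz] at s2
  simp only [hx, one_pow, mul_one, hw] at s1
  set δ := ε * √k / 20 with hδ
  have hδ0 : 0 ≤ δ := by positivity
  have key : |k * (k - 1) * (‖L z‖ ^ 2 - ‖z‖ ^ 2) + k * (∑ i, w i * (‖L (x i)‖ ^ 2 - 1))| ≤
      δ * (k * (k - 1) * ‖z‖ ^ 2 + k) := by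
    have e : k * (k - 1) * (‖L z‖ ^ 2 - ‖z‖ ^ 2) + k * (∑ i, w i * (‖L (x i)‖ ^ 2 - 1)) =
        ∑ f : Fin k → Fin n, (∏ j, w (f j)) *
          (‖L (∑ j, x (f j))‖ ^ 2 - ‖∑ j, x (f j)‖ ^ 2) := by
      simp only [mul_sub, Finset.sum_sub_distrib, map_sum, s1, s2, mul_one, hw]
      ring
    rw [e, ← s1, Finset.mul_sum]
    refine (Finset.abs_sum_le_sum_abs _ _).trans (Finset.sum_le_sum fun f _ => ?_)
    have hp : 0 ≤ ∏ j, w (f j) := Finset.prod_nonneg fun j _ => hw0 _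
    rw [abs_mul, abs_of_nonneg hp]
    calc _ ≤ (∏ j, w (f j)) * (δ * ‖∑ j, x (f j)‖ ^ 2) := by gcongr; exact Hk f
      _ = _ := by ring
  have hV : |∑ i, w i * (‖L (x i)‖ ^ 2 - 1)| ≤ ε / 20 := by
    calc _ ≤ ∑ i, |w i * (‖L (x i)‖ ^ 2 - 1)| := Finset.abs_sum_le_sum_abs _ _
      _ ≤ ∑ i, w i * (ε / 20) := by
        refine Finset.sum_le_sum fun i _ => ?_
        rw [abs_mul, abs_of_nonneg (hw0 i)]
        exact mul_le_mul_of_nonneg_left (H1 i) (hw0 i)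
      _ = ε / 20 := by rw [← Finset.sum_mul, hw, one_mul]
  -- bound on δ r
  have hδr : δ * r ≤ ε * (7 / 4) / 20 := by
    have : √k ≤ 7 / 4 * r⁻¹ := by
      rw [Real.sqrt_le_left (by positivity)]
      nlinarith
    calc δ * r ≤ (ε * (7 / 4 * r⁻¹) / 20) * r := by rw [hδ]; gcongr
      _ = _ := by field_simp
  have hk0 : (0 : ℝ) < k := by linarith
  have hkr : 1 ≤ k * r ^ 2 := by by_contra hc; push Not at hc; linarith [mul_le_mul_of_nonneg_right hk1 (sq_nonneg r)]
  set V := ∑ i, w i * (‖L (x i)‖ ^ 2 - 1)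
  set q := ‖L z‖ ^ 2 - ‖z‖ ^ 2 with hq
  have hzr : ‖z‖ ^ 2 ≤ r ^ 2 := by gcongr
  have hq1 : |q| < ε * r := by
    have a1 : k * (k - 1) * |q| ≤ δ * (k * (k - 1) * ‖z‖ ^ 2 + k) + k * (ε / 20) := by
      have : k * (k - 1) * |q| = |(k * (k - 1) * q + k * V) - k * V| := by
        rw [add_sub_cancel_right, abs_mul, abs_of_nonneg (by nlinarith : 0 ≤ (k : ℝ) * (k - 1))]
      rw [this]
      refine (abs_sub _ _).trans (add_le_add key ?_)
      rw [abs_mul, abs_of_pos hk0]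
      gcongr
    have a2 : (k - 1) * |q| ≤ δ * ((k - 1) * ‖z‖ ^ 2 + 1) + ε / 20 := by
      refine le_of_mul_le_mul_left ?_ hk0
      linarith
    have a3 : k / 2 * |q| ≤ (k - 1) * |q| := by gcongr; linarith
    have a4 : δ * ((k - 1) * ‖z‖ ^ 2 + 1) ≤ δ * (2 * k * r ^ 2) := by
      gcongr
      have b1 : (k - 1 : ℝ) * ‖z‖ ^ 2 ≤ k * r ^ 2 :=
        mul_le_mul (by linarith) hzr (sq_nonneg _) hk0.le
      linarith
    have a5 : δ * (2 * k * r ^ 2) ≤ (ε * (7 / 4) / 20) * (2 * k * r) := by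
      calc _ = (δ * r) * (2 * k * r) := by ring
        _ ≤ _ := by gcongr
    have a6 : ε / 20 ≤ k * (ε * r) / 20 := by
      have : 1 ≤ k * r := by
        refine hkr.trans (mul_le_mul_of_nonneg_left ?_ hk0.le)
        rw [sq]; exact mul_le_of_le_one_left hr0.le hr1
      have b2 : ε * 1 ≤ ε * (k * r) := mul_le_mul_of_nonneg_left this hε.le
      linarith
    have a7 : 0 < k * (ε * r) := by positivity
    refine lt_of_mul_lt_mul_left (a := (k : ℝ)) ?_ hk0.le
    linarith
  have hfac : q = (‖L z‖ - ‖z‖) * (‖L z‖ + ‖z‖) := by rw [hq]; ring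
  rw [hfac, abs_mul, abs_of_nonneg (by positivity : 0 ≤ ‖L z‖ + ‖z‖)] at hq1
  by_contra! hcon
  have hge : r ≤ ‖L z‖ + ‖z‖ := by
    refine max_le (by linarith [norm_nonneg (L z)]) (hcon.trans ?_)
    rw [abs_le]; constructor <;> linarith [norm_nonneg (L z), norm_nonneg z]
  have := mul_le_mul hcon hge hr0.le (abs_nonneg _)
  linarith

/-- law of a linear functional -/
lemma map_lin {d : ℕ} (s S : ℝ≥0) (v : Fin d → ℝ) (hS : (S : ℝ) = s * ∑ j, v j ^ 2) :
    (Measure.pi fun _ : Fin d => gaussianReal 0 s).map (fun ω => ∑ j, ω j * v j) =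
      gaussianReal 0 S := by
  have hm : Measurable (fun ω : Fin d → ℝ => ∑ j, ω j * v j) := by fun_prop
  have : IsProbabilityMeasure ((Measure.pi fun _ : Fin d => gaussianReal 0 s).map
    (fun ω => ∑ j, ω j * v j)) := Measure.isProbabilityMeasure_map hm.aemeasurable
  apply Measure.ext_of_charFun
  ext t
  rw [charFun_apply_real, integral_map hm.aemeasurable (by fun_prop), charFun_gaussianReal]
  have : ∀ ω : Fin d → ℝ, Complex.exp (t * ((∑ j, ω j * v j : ℝ) : ℂ) * Complex.I) =
      ∏ j, Complex.exp ((t * v j : ℝ) * ω j * Complex.I) := by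
    intro ω
    rw [← Complex.exp_sum]
    congr 1
    push_cast
    rw [Finset.mul_sum, Finset.sum_mul]
    exact Finset.sum_congr rfl fun j _ => by ring
  simp only [this]
  rw [integral_fintype_prod_eq_prod
    (f := fun (j : Fin d) (y : ℝ) => Complex.exp ((t * v j : ℝ) * y * Complex.I))]
  simp only [← charFun_apply_real, charFun_gaussianReal]
  have hS' : (S : ℂ) = s * ∑ j, (v j : ℂ) ^ 2 := by
    have := congrArg (fun a : ℝ => (a : ℂ)) hS
    push_cast at this
    exact this
  rw [← Complex.exp_sum, hS']
  congr 1
  push_cast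
  simp only [mul_zero, zero_mul, zero_sub, Finset.sum_neg_distrib]
  simp only [Finset.mul_sum, Finset.sum_mul, Finset.sum_div]
  congr 1
  exact Finset.sum_congr rfl fun j _ => by ring

lemma gauss_sq (s : ℝ≥0) (t : ℝ) (h : |2 * t * s| ≤ 1 / 2) :
    Integrable (fun y : ℝ => Real.exp (t * y ^ 2)) (gaussianReal 0 s) ∧
    ∫ y, Real.exp (t * y ^ 2) ∂(gaussianReal 0 s) ≤ Real.exp (t * s + 4 * (t * s) ^ 2) := by
  rcases eq_or_ne s 0 with rfl | hs
  · simp [gaussianReal_zero_var]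
    exact integrable_dirac (by simp)
  have hs0 : (0 : ℝ) < s := by positivity
  have hb : 0 < 1 / (2 * s) - t := by
    rw [sub_pos, lt_div_iff₀ (by positivity)]
    linarith [le_abs_self (2 * t * s)]
  have e : ∀ y : ℝ, gaussianPDFReal 0 s y • Real.exp (t * y ^ 2) =
      (√(2 * Real.pi * s))⁻¹ * Real.exp (-(1 / (2 * s) - t) * y ^ 2) := by
    intro y
    rw [gaussianPDFReal, smul_eq_mul, mul_assoc, ← Real.exp_add]
    congr 2
    field_simp
    ring
  constructor
  · rw [gaussianReal_of_var_ne_zero _ hs]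
    unfold gaussianPDF
    rw [integrable_withDensity_iff_integrable_smul' (by fun_prop) (by simp)]
    simp only [ENNReal.toReal_ofReal (gaussianPDFReal_nonneg _ _ _), e]
    exact (integrable_exp_neg_mul_sq hb).const_mul _
  · rw [integral_gaussianReal_eq_integral_smul hs]
    simp only [e]
    rw [integral_const_mul, integral_gaussian, ← Real.sqrt_inv, ← Real.sqrt_mul (by positivity)]
    have hu : (2 * Real.pi * s)⁻¹ * (Real.pi / (1 / (2 * s) - t)) = (1 - 2 * t * s)⁻¹ := by
      have := hb.ne'
      have h2 : 1 - 2 * t * s ≠ 0 := by linarith [le_abs_self (2 * t * s)]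
      have h3 : (1 / (2 * s) - t) = (1 - 2 * t * s) / (2 * s) := by field_simp
      rw [h3]
      field_simp [Real.pi_ne_zero]
    rw [hu, Real.sqrt_le_left (by positivity), ← Real.exp_nat_mul]
    set u := 2 * t * s with hu'
    have hu1 : 1 / 2 ≤ 1 - u := by linarith [le_abs_self u]
    rw [← Real.exp_log (by positivity : 0 < (1 - u)⁻¹)]
    apply Real.exp_le_exp.2
    have : Real.log ((1 - u)⁻¹) ≤ (1 - u)⁻¹ - 1 := Real.log_le_sub_one_of_pos (by positivity)
    refine this.trans ?_
    have : (1 - u)⁻¹ - 1 ≤ u + 2 * u ^ 2 := by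
      have : (1 - u)⁻¹ ≤ u + 2 * u ^ 2 + 1 := by
        rw [inv_le_iff_one_le_mul₀ (by linarith)]
        nlinarith [sq_nonneg u, mul_nonneg (sq_nonneg u) (by linarith : 0 ≤ 1 - 2 * u)]
      linarith
    refine this.trans (le_of_eq ?_)
    push_cast; rw [hu']; ring

lemma norm_sq_eq {m d : ℕ} (ω : Fin m → Fin d → ℝ) (v : EuclideanSpace ℝ (Fin d)) :
    ‖Matrix.toEuclideanLin (Matrix.of ω) v‖ ^ 2 = ∑ i, (∑ j, ω i j * v j) ^ 2 := by
  rw [EuclideanSpace.norm_sq_eq]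
  refine Finset.sum_congr rfl fun i _ => ?_
  simp [Matrix.toLpLin_apply, Matrix.mulVec, dotProduct]

lemma mgf_bound {m d : ℕ} (hm : 0 < m) (v : EuclideanSpace ℝ (Fin d)) (hv : v ≠ 0) (θ : ℝ)
    (hθ : |2 * θ| ≤ 1 / 2) :
    Integrable (fun ω : Fin m → Fin d → ℝ => Real.exp (θ * m / ‖v‖ ^ 2 *
      (‖Matrix.toEuclideanLin (Matrix.of ω) v‖ ^ 2)))
      (Measure.pi fun _ : Fin m => Measure.pi fun _ : Fin d => gaussianReal 0 (1 / m : ℝ≥0)) ∧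
    ∫ ω : Fin m → Fin d → ℝ, Real.exp (θ * m / ‖v‖ ^ 2 *
      (‖Matrix.toEuclideanLin (Matrix.of ω) v‖ ^ 2))
      ∂(Measure.pi fun _ : Fin m => Measure.pi fun _ : Fin d => gaussianReal 0 (1 / m : ℝ≥0))
      ≤ Real.exp (m * (θ + 4 * θ ^ 2)) := by
  have hv0 : 0 < ‖v‖ := norm_pos_iff.2 hv
  have hm0 : (0 : ℝ) < m := by exact_mod_cast hm
  set t := θ * m / ‖v‖ ^ 2 with ht
  set S : ℝ≥0 := Real.toNNReal (‖v‖ ^ 2 / m) with hS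
  have hSr : (S : ℝ) = ‖v‖ ^ 2 / m := Real.coe_toNNReal _ (by positivity)
  have htS : t * S = θ := by rw [ht, hSr]; field_simp
  obtain ⟨g1, g2⟩ := gauss_sq S t (by rw [mul_assoc, htS]; exact hθ)
  have hmeas : Measurable (fun ω : Fin d → ℝ => ∑ j, ω j * v j) := by fun_prop
  rw [← map_lin (1 / m : ℝ≥0) S v (by
    rw [hSr, EuclideanSpace.norm_sq_eq]; push_cast; simp only [Real.norm_eq_abs, sq_abs]; ring)]
    at g1 g2
  rw [integrable_map_measure (by fun_prop) hmeas.aemeasurable] at g1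
  rw [integral_map hmeas.aemeasurable (by fun_prop)] at g2
  have e : ∀ ω : Fin m → Fin d → ℝ,
      Real.exp (t * (‖Matrix.toEuclideanLin (Matrix.of ω) v‖ ^ 2)) =
      ∏ i, Real.exp (t * (∑ j, ω i j * v j) ^ 2) := by
    intro ω
    rw [norm_sq_eq, Finset.mul_sum, Real.exp_sum]
  simp only [e]
  constructor
  · exact Integrable.fintype_prod
      (f := fun (_ : Fin m) (y : Fin d → ℝ) => Real.exp (t * (∑ j, y j * v j) ^ 2)) (fun _ => g1)
  · rw [integral_fintype_prod_eq_prod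
      (f := fun (_ : Fin m) (y : Fin d → ℝ) => Real.exp (t * (∑ j, y j * v j) ^ 2))]
    refine (Finset.prod_le_prod (fun _ _ => integral_nonneg fun _ => (Real.exp_pos _).le)
      (fun _ _ => g2)).trans (le_of_eq ?_)
    rw [htS, Finset.prod_const, ← Real.exp_nat_mul]
    simp

lemma jl {m d : ℕ} (hm : 0 < m) (v : EuclideanSpace ℝ (Fin d)) (δ : ℝ) (hδ : 0 ≤ δ)
    (hδ2 : δ ≤ 2) :
    (Measure.pi fun _ : Fin m => Measure.pi fun _ : Fin d => gaussianReal 0 (1 / m : ℝ≥0)).real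
      {ω | ¬ |‖Matrix.toEuclideanLin (Matrix.of ω) v‖ ^ 2 - ‖v‖ ^ 2| ≤ δ * ‖v‖ ^ 2} ≤
      2 * Real.exp (-(m * δ ^ 2 / 16)) := by
  rcases eq_or_ne v 0 with rfl | hv
  · simp; positivity
  have hv0 : 0 < ‖v‖ := norm_pos_iff.2 hv
  have hm0 : (0 : ℝ) < m := by exact_mod_cast hm
  set μ := (Measure.pi fun _ : Fin m => Measure.pi fun _ : Fin d => gaussianReal 0 (1 / m : ℝ≥0))
  set X : (Fin m → Fin d → ℝ) → ℝ := fun ω => ‖Matrix.toEuclideanLin (Matrix.of ω) v‖ ^ 2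
  have hsub : {ω | ¬ |‖Matrix.toEuclideanLin (Matrix.of ω) v‖ ^ 2 - ‖v‖ ^ 2| ≤ δ * ‖v‖ ^ 2} ⊆
      {ω | (1 + δ) * ‖v‖ ^ 2 ≤ X ω} ∪ {ω | X ω ≤ (1 - δ) * ‖v‖ ^ 2} := by
    intro ω hω
    simp only [Set.mem_ofPred, not_le, lt_abs] at hω
    rcases hω with h | h
    · left; simp only [Set.mem_ofPred, X]; linarith
    · right; simp only [Set.mem_ofPred, X]; linarith
  have h1 : μ.real {ω | (1 + δ) * ‖v‖ ^ 2 ≤ X ω} ≤ Real.exp (-(m * δ ^ 2 / 16)) := by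
    obtain ⟨i1, i2⟩ := mgf_bound hm v hv (δ / 8) (by rw [abs_of_nonneg] <;> linarith)
    refine (measure_ge_le_exp_mul_mgf _ (by positivity : 0 ≤ δ / 8 * m / ‖v‖ ^ 2) i1).trans ?_
    refine (mul_le_mul_of_nonneg_left i2 (Real.exp_pos _).le).trans ?_
    rw [← Real.exp_add]
    apply Real.exp_le_exp.2
    field_simp
    apply le_of_eq; ring
  have h2 : μ.real {ω | X ω ≤ (1 - δ) * ‖v‖ ^ 2} ≤ Real.exp (-(m * δ ^ 2 / 16)) := by
    obtain ⟨i1, i2⟩ := mgf_bound hm v hv (-(δ / 8)) (by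
      rw [mul_neg, abs_neg, abs_of_nonneg] <;> linarith)
    refine (measure_le_le_exp_mul_mgf _ (by
      rw [neg_mul, neg_div]; exact neg_nonpos.2 (by positivity)) i1).trans ?_
    refine (mul_le_mul_of_nonneg_left i2 (Real.exp_pos _).le).trans ?_
    rw [← Real.exp_add]
    apply Real.exp_le_exp.2
    field_simp
    apply le_of_eq; ring
  refine (measureReal_mono hsub).trans ((measureReal_union_le _ _).trans ?_)
  linarith

end CHD

/-- **Corollary (MainL1Result).** There is a universal constant `c > 0` so that for
`ε ∈ (0,1)` with `1 ≤ ε⁻² < n`, unit vectors `x₁,…,xₙ`, and `m ≥ c·ε⁻²·log n`, a random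
`m × d` matrix with i.i.d. `N(0, 1/m)` entries provides `ε`-convex hull distortion for
`{x₁,…,xₙ}` with probability at least `1 - 1/n`. -/
theorem gaussian_matrix_chd_whp :
    ∃ c : ℝ, 0 < c ∧
      ∀ (d n : ℕ) (ε : ℝ), 0 < ε → ε < 1 → 1 ≤ ε⁻¹ ^ 2 → ε⁻¹ ^ 2 < (n : ℝ) →
        ∀ x : Fin n → EuclideanSpace ℝ (Fin d), (∀ i, ‖x i‖ = 1) →
          ∀ m : ℕ, c * ε⁻¹ ^ 2 * Real.log n ≤ (m : ℝ) →
            ENNReal.ofReal (1 - 1 / n) ≤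
              (Measure.pi fun _ : Fin m => Measure.pi fun _ : Fin d =>
                  gaussianReal 0 (1 / m : ℝ≥0))
                {ω | ProvidesConvexHullDistortion ε (Matrix.of ω) (Set.range x)} := by
  refine ⟨38400, by norm_num, ?_⟩
  intro d n ε hε hε1 hε2 hεn x hx m hm
  set μ := (Measure.pi fun _ : Fin m => Measure.pi fun _ : Fin d => gaussianReal 0 (1 / m : ℝ≥0))
  have hn1 : (1 : ℝ) < n := hε2.trans_lt hεn
  have hn2 : 2 ≤ n := by
    have : 1 < n := by exact_mod_cast hn1
    omega
  have hn2' : (2 : ℝ) ≤ n := by exact_mod_cast hn2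
  have hlog : 0 < Real.log n := Real.log_pos hn1
  have hmr : (0 : ℝ) < m := lt_of_lt_of_le (by positivity) hm
  have hm0 : 0 < m := by exact_mod_cast hmr
  have hmε : 38400 * Real.log n ≤ m * ε ^ 2 := by
    calc 38400 * Real.log n = 38400 * ε⁻¹ ^ 2 * Real.log n * ε ^ 2 := by field_simp
      _ ≤ _ := by gcongr
  set K := ⌊3 * ε⁻¹ ^ 2⌋₊ with hK
  have hKle : (K : ℝ) ≤ 3 * ε⁻¹ ^ 2 := Nat.floor_le (by positivity)
  let Bad : (k : ℕ) → (Fin k → Fin n) → Set (Fin m → Fin d → ℝ) := fun k f =>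
    {ω | ¬ |‖Matrix.toEuclideanLin (Matrix.of ω) (∑ j, x (f j))‖ ^ 2 - ‖∑ j, x (f j)‖ ^ 2| ≤
      ε * √k / 20 * ‖∑ j, x (f j)‖ ^ 2}
  let B : Set (Fin m → Fin d → ℝ) := ⋃ k ∈ Finset.Icc 1 K, ⋃ f ∈ (Finset.univ : Finset (Fin k → Fin n)), Bad k f
  have hBad : ∀ k ∈ Finset.Icc 1 K, ∀ f, μ.real (Bad k f) ≤ 2 * ((n : ℝ) ^ (6 * k))⁻¹ := by
    intro k hk f
    obtain ⟨hk1, hk2⟩ := Finset.mem_Icc.1 hk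
    have hkK : (k : ℝ) ≤ 3 * ε⁻¹ ^ 2 := le_trans (by exact_mod_cast hk2) hKle
    have hsq : (ε * √k / 20) ^ 2 = ε ^ 2 * k / 400 := by
      rw [div_pow, mul_pow, Real.sq_sqrt (by positivity)]; norm_num
    have hle : ε * √k / 20 ≤ 2 := by
      refine le_of_sq_le_sq ?_ (by norm_num)
      rw [hsq]
      have : ε ^ 2 * k ≤ ε ^ 2 * (3 * ε⁻¹ ^ 2) := by gcongr
      have e : ε ^ 2 * (3 * ε⁻¹ ^ 2) = 3 := by field_simp
      linarith
    refine (CHD.jl hm0 (∑ j, x (f j)) (ε * √k / 20) (by positivity) hle).trans ?_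
    gcongr
    rw [hsq, ← Real.exp_log (by positivity : 0 < (n : ℝ) ^ (6 * k)), ← Real.exp_neg, Real.log_pow]
    apply Real.exp_le_exp.2
    have := mul_le_mul_of_nonneg_right hmε (Nat.cast_nonneg (α := ℝ) k)
    push_cast
    linarith
  have hB : μ.real B ≤ 1 / n := by
    have h1 : μ.real B ≤ ∑ k ∈ Finset.Icc 1 K, ∑ f : Fin k → Fin n, μ.real (Bad k f) :=
      (measureReal_biUnion_finset_le _ _).trans
        (Finset.sum_le_sum fun k _ => measureReal_biUnion_finset_le _ _)
    have h2 : ∀ k ∈ Finset.Icc 1 K, ∑ f : Fin k → Fin n, μ.real (Bad k f) ≤ 2 * ((n : ℝ) ^ 5)⁻¹ := by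
      intro k hk
      refine (Finset.sum_le_sum fun f _ => hBad k hk f).trans ?_
      obtain ⟨hk1, hk2⟩ := Finset.mem_Icc.1 hk
      simp only [Finset.sum_const, Finset.card_univ, Fintype.card_fun, Fintype.card_fin,
        nsmul_eq_mul]
      push_cast
      have e : (n : ℝ) ^ k * (2 * ((n : ℝ) ^ (6 * k))⁻¹) = 2 * ((n : ℝ) ^ (5 * k))⁻¹ := by
        rw [show 6 * k = k + 5 * k by ring, pow_add]
        field_simp
      rw [e]
      gcongr
      · exact hn1.le
      · omega
    refine h1.trans ((Finset.sum_le_sum h2).trans ?_)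
    simp only [Finset.sum_const, Nat.card_Icc, add_tsub_cancel_right, nsmul_eq_mul]
    have hK3 : (K : ℝ) ≤ 3 * n := by linarith
    calc (K : ℝ) * (2 * ((n : ℝ) ^ 5)⁻¹) ≤ 3 * n * (2 * ((n : ℝ) ^ 5)⁻¹) := by gcongr
      _ = 6 / (n : ℝ) ^ 3 * (1 / n) := by field_simp; norm_num
      _ ≤ 1 * (1 / n) := by
        gcongr
        rw [div_le_one (by positivity)]
        have : (2 : ℝ) ^ 3 ≤ (n : ℝ) ^ 3 := by gcongr
        linarith
      _ = 1 / n := one_mul _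
  have hsub : Bᶜ ⊆ {ω | ProvidesConvexHullDistortion ε (Matrix.of ω) (Set.range x)} := by
    intro ω hω z hz
    refine CHD.det_step (Matrix.toEuclideanLin (Matrix.of ω)) ε hε hε1 x hx ?_ z hz
    intro k hk1 hk2 f
    by_contra hcon
    apply hω
    simp only [B, Set.mem_iUnion]
    exact ⟨k, Finset.mem_Icc.2 ⟨hk1, Nat.le_floor hk2⟩, f, Finset.mem_univ _, hcon⟩
  refine le_trans ?_ (measure_mono hsub)
  have h3 : (1 : ℝ) ≤ μ.real B + μ.real Bᶜ := by
    have := measureReal_union_le (μ := μ) B Bᶜ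
    rwa [Set.union_compl_self, probReal_univ] at this
  rw [← ofReal_measureReal]
  exact ENNReal.ofReal_le_ofReal (by linarith)
end

section
/- There exists a universal constant C > 0 such that for every ε ∈ (0,1), every n ≥ 2, and every set X = {x₁, …, xₙ} ⊂ S^{d−1} of n unit vectors in ℝ^d, there exist a natural number m ≤ C·ε⁻²·log n and a matrix Π ∈ ℝ^{m×d} that provides ε-convex hull distortion for X. -/
open Finset in
lemma chd_sum_cons {α : Type*} [Fintype α] (k : ℕ) (F : (Fin (k+1) → α) → ℝ) :
    ∑ f : Fin (k+1) → α, F f = ∑ a : α, ∑ g : Fin k → α, F (Fin.cons a g) := by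
  rw [← Fintype.sum_prod_type' (f := fun a (g : Fin k → α) => F (Fin.cons a g))]
  exact (Fintype.sum_equiv (Fin.consEquiv (fun _ => α)) _ _ (fun x => rfl)).symm

/-- Second moment of a `k`-fold empirical sum. -/
lemma chd_emp {n : ℕ} {F : Type*} [NormedAddCommGroup F] [InnerProductSpace ℝ F]
    (p : Fin n → ℝ) (hp : ∑ i, p i = 1) (x : Fin n → F) (k : ℕ) : ∀ w : F,
    ∑ f : Fin k → Fin n, (∏ j, p (f j)) * ‖w + ∑ j, x (f j)‖ ^ 2 =
      ‖w‖ ^ 2 + 2 * k * inner ℝ w (∑ i, p i • x i) + k * ∑ i, p i * ‖x i‖ ^ 2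
        + k * (k - 1) * ‖∑ i, p i • x i‖ ^ 2 := by
  induction k with
  | zero => intro w; simp
  | succ k ih =>
    intro w
    rw [chd_sum_cons]
    have h1 : ∀ a : Fin n, ∑ g : Fin k → Fin n,
        (∏ j, p ((Fin.cons a g : Fin (k+1) → Fin n) j)) *
          ‖w + ∑ j, x ((Fin.cons a g : Fin (k+1) → Fin n) j)‖ ^ 2
        = p a * (‖w + x a‖ ^ 2 + 2 * k * inner ℝ (w + x a) (∑ i, p i • x i)
          + k * ∑ i, p i * ‖x i‖ ^ 2 + k * (k - 1) * ‖∑ i, p i • x i‖ ^ 2) := by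
      intro a
      rw [← ih (w + x a), Finset.mul_sum]
      refine Finset.sum_congr rfl fun g _ => ?_
      rw [Fin.prod_univ_succ, Fin.sum_univ_succ]
      simp only [Fin.cons_zero, Fin.cons_succ]
      rw [← add_assoc, mul_assoc]
    rw [Finset.sum_congr rfl fun a _ => h1 a]
    set S := ∑ i, p i * ‖x i‖ ^ 2 with hS
    set y := ∑ i, p i • x i with hy
    have h2 : ∑ i, p i * inner ℝ w (x i) = inner ℝ w y := by
      rw [hy, inner_sum]; simp [inner_smul_right]
    have h3 : ∑ i, p i * inner ℝ (x i) y = ‖y‖ ^ 2 := by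
      rw [← real_inner_self_eq_norm_sq]
      conv_rhs => rw [hy, sum_inner]
      simp [inner_smul_left, ← hy]
    have h4 : ∀ a, p a * (‖w + x a‖ ^ 2 + 2 * k * inner ℝ (w + x a) y + k * S
          + k * (k - 1) * ‖y‖ ^ 2) =
        (‖w‖ ^ 2 + 2 * k * inner ℝ w y + k * S + k * (k - 1) * ‖y‖ ^ 2) * p a
        + 2 * (p a * inner ℝ w (x a)) + p a * ‖x a‖ ^ 2 + 2 * k * (p a * inner ℝ (x a) y) := by
      intro a
      rw [norm_add_sq_real, inner_add_left]; ring
    rw [Finset.sum_congr rfl fun a _ => h4 a]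
    simp only [Finset.sum_add_distrib, ← Finset.mul_sum]
    rw [hp, h2, h3, ← hS]
    push_cast; ring

/-- The deterministic (Maurey-type) step. -/
lemma chd_det {n : ℕ} {E F : Type*} [NormedAddCommGroup E] [InnerProductSpace ℝ E]
    [NormedAddCommGroup F] [InnerProductSpace ℝ F] (L : E →ₗ[ℝ] F)
    (p : Fin n → ℝ) (hp : ∑ i, p i = 1) (hp0 : ∀ i, 0 ≤ p i) (x : Fin n → E)
    (hx : ∀ i, ‖x i‖ = 1) (k : ℕ) (hk : 2 ≤ k) (δ : ℝ)
    (h : ∀ f : Fin k → Fin n, |‖L (∑ j, x (f j))‖ ^ 2 - ‖∑ j, x (f j)‖ ^ 2|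
      ≤ δ * ‖∑ j, x (f j)‖ ^ 2) :
    (k - 1) * |‖L (∑ i, p i • x i)‖ ^ 2 - ‖∑ i, p i • x i‖ ^ 2|
      ≤ δ * ((k - 1) * ‖∑ i, p i • x i‖ ^ 2 + 2) := by
  have hk' : (2 : ℝ) ≤ k := by exact_mod_cast hk
  have e1 := chd_emp p hp x k 0
  have e2 := chd_emp p hp (fun i => L (x i)) k 0
  simp only [zero_add, norm_zero, inner_zero_left, ← map_smul, ← map_sum] at e1 e2
  simp only [hx, one_pow, mul_one, hp] at e1
  set y := ∑ i, p i • x i with hy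
  have hsingle : ∀ i, |‖L (x i)‖ ^ 2 - 1| ≤ δ := by
    intro i
    have := h (fun _ => i)
    simp only [Finset.sum_const, Finset.card_univ, Fintype.card_fin, ← Nat.cast_smul_eq_nsmul ℝ,
      map_smul, norm_smul, hx, mul_pow] at this
    rw [← mul_sub, abs_mul, abs_of_nonneg (by positivity)] at this
    have hpos : (0 : ℝ) < ‖(k : ℝ)‖ ^ 2 := by
      rw [Real.norm_eq_abs]; positivity
    have h2 : ‖(k : ℝ)‖ ^ 2 * |‖L (x i)‖ ^ 2 - 1| ≤ ‖(k : ℝ)‖ ^ 2 * δ := by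
      simpa [mul_comm] using this
    exact le_of_mul_le_mul_left h2 hpos
  have hA : |∑ i, p i * ‖L (x i)‖ ^ 2 - 1| ≤ δ := by
    have : ∑ i, p i * ‖L (x i)‖ ^ 2 - 1 = ∑ i, p i * (‖L (x i)‖ ^ 2 - 1) := by
      simp [mul_sub, hp]
    rw [this]
    calc _ ≤ ∑ i, |p i * (‖L (x i)‖ ^ 2 - 1)| := Finset.abs_sum_le_sum_abs _ _
      _ ≤ ∑ i, p i * δ := Finset.sum_le_sum fun i _ => by
          rw [abs_mul, abs_of_nonneg (hp0 i)]
          exact mul_le_mul_of_nonneg_left (hsingle i) (hp0 i)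
      _ = δ := by rw [← Finset.sum_mul, hp, one_mul]
  have hB : |∑ f : Fin k → Fin n, (∏ j, p (f j)) * ‖L (∑ j, x (f j))‖ ^ 2
      - ∑ f : Fin k → Fin n, (∏ j, p (f j)) * ‖∑ j, x (f j)‖ ^ 2|
      ≤ δ * ∑ f : Fin k → Fin n, (∏ j, p (f j)) * ‖∑ j, x (f j)‖ ^ 2 := by
    rw [← Finset.sum_sub_distrib, Finset.mul_sum]
    refine (Finset.abs_sum_le_sum_abs _ _).trans (Finset.sum_le_sum fun f _ => ?_)
    have h0 : 0 ≤ ∏ j, p (f j) := Finset.prod_nonneg fun j _ => hp0 _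
    rw [← mul_sub, abs_mul, abs_of_nonneg h0]
    nlinarith [mul_le_mul_of_nonneg_left (h f) h0]
  rw [e1, e2] at hB
  set A := ∑ i, p i * ‖L (x i)‖ ^ 2
  rw [abs_le] at hA hB
  have hkp : (0:ℝ) < k := by linarith
  rw [← abs_of_nonneg (show (0:ℝ) ≤ (k:ℝ) - 1 by linarith), ← abs_mul,
    abs_of_nonneg (show (0:ℝ) ≤ (k:ℝ) - 1 by linarith), abs_le]
  constructor
  · refine le_of_mul_le_mul_left (a := (k:ℝ)) ?_ hkp
    nlinarith [mul_le_mul_of_nonneg_left hA.2 hkp.le]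
  · refine le_of_mul_le_mul_left (a := (k:ℝ)) ?_ hkp
    nlinarith [mul_le_mul_of_nonneg_left hA.1 hkp.le]

/-- Sign of a boolean. -/
def chdSgn (b : Bool) : ℝ := if b then 1 else -1

/-- Rademacher sum. -/
def chdX {d : ℕ} (z : Fin d → ℝ) (a : Fin d → Bool) : ℝ := ∑ i, chdSgn (a i) * z i

lemma chd_second {d : ℕ} : ∀ (z : Fin d → ℝ) (w : ℝ),
    ∑ a : Fin d → Bool, (w + chdX z a) ^ 2 = 2 ^ d * (w ^ 2 + ∑ i, z i ^ 2) := by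
  induction d with
  | zero => intro z w; simp [chdX]
  | succ d ih =>
    intro z w
    rw [chd_sum_cons]
    have : ∀ (b : Bool) (g : Fin d → Bool), w + chdX z (Fin.cons b g : Fin (d+1) → Bool)
        = (w + chdSgn b * z 0) + chdX (fun i => z i.succ) g := by
      intro b g
      simp only [chdX]
      rw [Fin.sum_univ_succ]
      simp only [Fin.cons_zero, Fin.cons_succ]
      ring
    simp only [this, ih, Fintype.sum_bool, chdSgn, Fin.sum_univ_succ (fun i => z i ^ 2)]
    simp
    ring

lemma chd_mgf {d : ℕ} (z : Fin d → ℝ) (s : ℝ) :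
    ∑ a : Fin d → Bool, Real.exp (s * chdX z a) ≤
      2 ^ d * Real.exp (s ^ 2 / 2 * ∑ i, z i ^ 2) := by
  have h : ∑ a : Fin d → Bool, Real.exp (s * chdX z a)
      = ∏ i, ∑ b : Bool, Real.exp (s * (chdSgn b * z i)) := by
    rw [Finset.prod_univ_sum]
    simp only [Fintype.piFinset_univ, chdX, Finset.mul_sum, Real.exp_sum]
  rw [h]
  have h2 : (2:ℝ) ^ d * Real.exp (s ^ 2 / 2 * ∑ i, z i ^ 2)
      = ∏ i, (2 * Real.exp ((s * z i) ^ 2 / 2)) := by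
    rw [Finset.prod_mul_distrib, ← Real.exp_sum, Finset.mul_sum]
    simp
    refine Finset.sum_congr rfl fun i _ => by ring
  rw [h2]
  refine Finset.prod_le_prod (fun i _ => by positivity) fun i _ => ?_
  have := Real.cosh_le_exp_half_sq (s * z i)
  rw [Real.cosh_eq] at this
  simp [chdSgn]
  linarith

lemma chd_gauss (s : ℝ) :
    ∫ g : ℝ, Real.exp (-(1/2) * g ^ 2 + s * g) = Real.exp (s ^ 2 / 2) * √(2 * Real.pi) := by
  have : ∀ g : ℝ, Real.exp (-(1/2) * g ^ 2 + s * g)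
      = Real.exp (s ^ 2 / 2) * Real.exp (-(1/2) * (g - s) ^ 2) := by
    intro g; rw [← Real.exp_add]; congr 1; ring
  simp only [this]
  rw [MeasureTheory.integral_const_mul,
    MeasureTheory.integral_sub_right_eq_self (fun g => Real.exp (-(1/2) * g ^ 2)) s,
    integral_gaussian]
  congr 2; ring

lemma chd_gauss_int (s : ℝ) :
    MeasureTheory.Integrable (fun g : ℝ => Real.exp (-(1/2) * g ^ 2 + s * g)) := by
  have : ∀ g : ℝ, Real.exp (-(1/2) * g ^ 2 + s * g)
      = Real.exp (s ^ 2 / 2) * Real.exp (-(1/2) * (g - s) ^ 2) := by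
    intro g; rw [← Real.exp_add]; congr 1; ring
  simp only [this]
  exact ((integrable_exp_neg_mul_sq (b := 1/2) (by norm_num)).comp_sub_right s).const_mul _

lemma chd_expsq {d : ℕ} (z : Fin d → ℝ) (hz : ∑ i, z i ^ 2 = 1) :
    ∑ a : Fin d → Bool, Real.exp (chdX z a ^ 2 / 4) ≤ 2 ^ d * √2 := by
  have hpi : 0 < √(2 * Real.pi) := by positivity
  have h2 : (√2) ^ 2 = 2 := Real.sq_sqrt (by norm_num)
  refine le_of_mul_le_mul_right (a := √(2 * Real.pi)) ?_ hpi
  calc (∑ a : Fin d → Bool, Real.exp (chdX z a ^ 2 / 4)) * √(2 * Real.pi)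
      = ∑ a : Fin d → Bool, ∫ g : ℝ, Real.exp (-(1/2) * g ^ 2 + (chdX z a / √2) * g) := by
        rw [Finset.sum_mul]
        refine Finset.sum_congr rfl fun a _ => ?_
        rw [chd_gauss, div_pow, h2]; congr 2; ring
    _ = ∫ g : ℝ, ∑ a : Fin d → Bool, Real.exp (-(1/2) * g ^ 2 + (chdX z a / √2) * g) :=
        (MeasureTheory.integral_finsetSum _ fun a _ => chd_gauss_int _).symm
    _ ≤ ∫ g : ℝ, 2 ^ d * Real.exp (-(1/4) * g ^ 2) := by
        refine MeasureTheory.integral_mono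
          (MeasureTheory.integrable_finsetSum _ fun a _ => chd_gauss_int _)
          ((integrable_exp_neg_mul_sq (b := 1/4) (by norm_num)).const_mul _) fun g => ?_
        have := chd_mgf z (g / √2)
        rw [hz, div_pow, h2] at this
        have e : ∀ a, Real.exp (-(1/2) * g ^ 2 + (chdX z a / √2) * g)
            = Real.exp (-(1/2) * g ^ 2) * Real.exp (g / √2 * chdX z a) := by
          intro a; rw [← Real.exp_add]; congr 1; ring
        simp only [e, ← Finset.mul_sum]
        calc _ ≤ Real.exp (-(1/2) * g ^ 2) * (2 ^ d * Real.exp (g ^ 2 / 2 / 2 * 1)) := by gcongr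
          _ = 2 ^ d * (Real.exp (-(1/2) * g ^ 2) * Real.exp (g ^ 2 / 2 / 2 * 1)) := by ring
          _ = _ := by rw [← Real.exp_add]; congr 2; ring
    _ = 2 ^ d * √2 * √(2 * Real.pi) := by
        rw [MeasureTheory.integral_const_mul, integral_gaussian, mul_assoc, ← Real.sqrt_mul (by norm_num)]
        congr 2; ring

lemma chd_exp_bound (u : ℝ) : Real.exp u ≤ 1 + u + u ^ 2 * Real.exp |u| := by
  have := Complex.norm_exp_sub_sum_le_norm_mul_exp (u : ℂ) 2
  have e : Complex.exp u - ∑ m ∈ Finset.range 2, (u : ℂ) ^ m / (m.factorial : ℂ)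
      = ((Real.exp u - (1 + u) : ℝ) : ℂ) := by
    simp [Finset.sum_range_succ]
  rw [e, Complex.norm_real, Complex.norm_real, Real.norm_eq_abs, Real.norm_eq_abs, sq_abs] at this
  linarith [le_abs_self (Real.exp u - (1 + u))]

lemma chd_row {d : ℕ} (z : Fin d → ℝ) (hz : ∑ i, z i ^ 2 = 1) (t : ℝ) (ht : |t| ≤ 1/8) :
    ∑ a : Fin d → Bool, Real.exp (t * chdX z a ^ 2) ≤ 2 ^ d * Real.exp (t + 200 * t ^ 2) := by
  have hpt : ∀ a, Real.exp (t * chdX z a ^ 2) ≤ 1 + t * chdX z a ^ 2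
      + t ^ 2 * 128 * Real.exp (chdX z a ^ 2 / 4) := by
    intro a
    set X := chdX z a
    have h1 := chd_exp_bound (t * X ^ 2)
    have h2 : X ^ 4 ≤ 128 * Real.exp (X ^ 2 / 8) := by
      have := Real.quadratic_le_exp_of_nonneg (x := X ^ 2 / 8) (by positivity)
      nlinarith [sq_nonneg X]
    have h3 : Real.exp |t * X ^ 2| ≤ Real.exp (X ^ 2 / 8) := by
      apply Real.exp_le_exp.2
      rw [abs_mul, abs_of_nonneg (sq_nonneg X)]
      nlinarith [sq_nonneg X]
    have h4 : X ^ 4 * Real.exp |t * X ^ 2| ≤ 128 * Real.exp (X ^ 2 / 4) := by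
      calc _ ≤ (128 * Real.exp (X ^ 2 / 8)) * Real.exp (X ^ 2 / 8) := by gcongr
        _ = 128 * (Real.exp (X ^ 2 / 8) * Real.exp (X ^ 2 / 8)) := by ring
        _ = _ := by rw [← Real.exp_add]; congr 2; ring
    nlinarith [mul_le_mul_of_nonneg_left h4 (sq_nonneg t)]
  have hs := chd_second z 0
  simp only [zero_add, hz] at hs
  have he := chd_expsq z hz
  have hs2 : √2 ≤ 1.5 := by
    rw [Real.sqrt_le_left (by norm_num)]; norm_num
  calc _ ≤ ∑ a : Fin d → Bool, (1 + t * chdX z a ^ 2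
      + t ^ 2 * 128 * Real.exp (chdX z a ^ 2 / 4)) := Finset.sum_le_sum fun a _ => hpt a
    _ = 2 ^ d + t * 2 ^ d + t ^ 2 * 128 * ∑ a : Fin d → Bool, Real.exp (chdX z a ^ 2 / 4) := by
      simp only [Finset.sum_add_distrib, ← Finset.mul_sum, hs]
      simp
    _ ≤ 2 ^ d + t * 2 ^ d + t ^ 2 * 128 * (2 ^ d * 1.5) := by
      gcongr
      exact he.trans (by gcongr)
    _ ≤ 2 ^ d * (1 + (t + 200 * t ^ 2)) := by
      have : (0:ℝ) < 2 ^ d := by positivity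
      nlinarith [mul_nonneg this.le (sq_nonneg t)]
    _ ≤ _ := by
      gcongr
      linarith [Real.add_one_le_exp (t + 200 * t ^ 2)]

lemma chd_tail {d m : ℕ} (z : Fin d → ℝ) (hz : ∑ i, z i ^ 2 = 1) (t : ℝ) (ht : |t| ≤ 1/8) (c : ℝ) :
    ∑ ω : Fin m → Fin d → Bool, Real.exp (t * ∑ r, chdX z (ω r) ^ 2 - c) ≤
      (2 ^ d) ^ m * Real.exp (m * (t + 200 * t ^ 2) - c) := by
  have h : ∑ ω : Fin m → Fin d → Bool, Real.exp (t * ∑ r, chdX z (ω r) ^ 2 - c)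
      = (∑ a : Fin d → Bool, Real.exp (t * chdX z a ^ 2)) ^ m * Real.exp (-c) := by
    rw [Fintype.sum_pow, Finset.sum_mul]
    refine Finset.sum_congr rfl fun ω _ => ?_
    rw [← Real.exp_sum, ← Real.exp_add, Finset.mul_sum, sub_eq_add_neg]
  rw [h]
  calc _ ≤ (2 ^ d * Real.exp (t + 200 * t ^ 2)) ^ m * Real.exp (-c) := by
        gcongr
        exact chd_row z hz t ht
    _ = _ := by
        rw [mul_pow, ← Real.exp_nat_mul, mul_assoc, ← Real.exp_add, sub_eq_add_neg]

lemma chd_jl {ι : Type*} [Fintype ι] {d m : ℕ} (z : ι → Fin d → ℝ) (δ : ι → ℝ)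
    (hδ0 : ∀ i, 0 ≤ δ i) (hδ : ∀ i, δ i ≤ 50)
    (hsum : ∑ i, 2 * Real.exp (-(m * δ i ^ 2 / 800)) < 1) :
    ∃ ω : Fin m → Fin d → Bool, ∀ i,
      |∑ r, chdX (z i) (ω r) ^ 2 - m * ∑ j, z i j ^ 2| ≤ m * (δ i * ∑ j, z i j ^ 2) := by
  classical
  by_contra hcon
  push Not at hcon
  set N : ι → ℝ := fun i => ∑ j, z i j ^ 2 with hN
  have hN0 : ∀ i, 0 ≤ N i := fun i => Finset.sum_nonneg fun j _ => sq_nonneg _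
  set s : Finset ι := Finset.univ.filter fun i => N i ≠ 0 with hs
  set u : ι → Fin d → ℝ := fun i j => z i j / √(N i) with hu
  have hXu : ∀ i a, chdX (u i) a ^ 2 = chdX (z i) a ^ 2 / N i := by
    intro i a
    have : chdX (u i) a = chdX (z i) a / √(N i) := by
      simp only [chdX, hu, Finset.sum_div, mul_div_assoc]
    rw [this, div_pow, Real.sq_sqrt (hN0 i)]
  have hu1 : ∀ i, N i ≠ 0 → ∑ j, u i j ^ 2 = 1 := by
    intro i hi
    simp only [hu, div_pow, Real.sq_sqrt (hN0 i), ← Finset.sum_div]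
    exact div_self hi
  set P : ι → (Fin m → Fin d → Bool) → ℝ := fun i ω =>
    Real.exp (δ i / 400 * ∑ r, chdX (u i) (ω r) ^ 2 - δ i / 400 * (m * (1 + δ i)))
    + Real.exp (-(δ i / 400) * ∑ r, chdX (u i) (ω r) ^ 2 - -(δ i / 400) * (m * (1 - δ i))) with hP
  have hP0 : ∀ i ω, 0 ≤ P i ω := fun i ω => by simp only [hP]; positivity
  have hub : ∀ i ∈ s, ∑ ω, P i ω ≤ (2 ^ d) ^ m * (2 * Real.exp (-(m * δ i ^ 2 / 800))) := by
    intro i hi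
    have hi' : N i ≠ 0 := by simpa [hs] using hi
    have ht : |δ i / 400| ≤ 1 / 8 := by
      rw [abs_of_nonneg (by linarith [hδ0 i])]; linarith [hδ i]
    have h1 := chd_tail (m := m) (u i) (hu1 i hi') (δ i / 400) ht (δ i / 400 * (m * (1 + δ i)))
    have h2 := chd_tail (m := m) (u i) (hu1 i hi') (-(δ i / 400)) (by rwa [abs_neg])
      (-(δ i / 400) * (m * (1 - δ i)))
    simp only [hP, Finset.sum_add_distrib]
    refine (add_le_add h1 h2).trans (le_of_eq ?_)
    rw [← mul_add, two_mul]
    congr 3 <;> ring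
  have hlb : ∀ ω, 1 ≤ ∑ i ∈ s, P i ω := by
    intro ω
    obtain ⟨i, hi⟩ := hcon ω
    have hNi : N i ≠ 0 := by
      intro h0
      have hz : ∀ j, z i j = 0 := by
        intro j
        have := (Finset.sum_eq_zero_iff_of_nonneg (fun j _ => sq_nonneg (z i j))).1 h0 j
          (Finset.mem_univ _)
        exact pow_eq_zero_iff (two_ne_zero) |>.1 this
      simp [chdX, hz] at hi
    have his : i ∈ s := by simpa [hs] using hNi
    refine le_trans ?_ (Finset.single_le_sum (fun j _ => hP0 j ω) his)
    have hNp : 0 < N i := lt_of_le_of_ne (hN0 i) (Ne.symm hNi)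
    have hS : ∑ r, chdX (z i) (ω r) ^ 2 = N i * ∑ r, chdX (u i) (ω r) ^ 2 := by
      simp only [hXu, ← Finset.sum_div]
      field_simp
    change m * (δ i * N i) < |∑ r, chdX (z i) (ω r) ^ 2 - m * N i| at hi
    rw [hS] at hi
    simp only [hP]
    set S := ∑ r, chdX (u i) (ω r) ^ 2
    have hd := hδ0 i
    rcases lt_abs.1 hi with h | h
    · have : m * (1 + δ i) < S := by
        refine lt_of_mul_lt_mul_left (a := N i) ?_ hNp.le
        linarith
      have h3 : 0 ≤ δ i / 400 * S - δ i / 400 * (m * (1 + δ i)) := by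
        rw [← mul_sub]; exact mul_nonneg (by linarith) (by linarith)
      have := Real.one_le_exp h3
      have := Real.exp_pos (-(δ i / 400) * S - -(δ i / 400) * (m * (1 - δ i)))
      linarith
    · have : S < m * (1 - δ i) := by
        refine lt_of_mul_lt_mul_left (a := N i) ?_ hNp.le
        linarith
      have h3 : 0 ≤ -(δ i / 400) * S - -(δ i / 400) * (m * (1 - δ i)) := by
        have := mul_nonneg (show 0 ≤ δ i / 400 by linarith) (show 0 ≤ m * (1 - δ i) - S by linarith)
        linarith
      have := Real.one_le_exp h3
      have := Real.exp_pos (δ i / 400 * S - δ i / 400 * (m * (1 + δ i)))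
      linarith
  have hcard : ((2:ℝ) ^ d) ^ m ≤ ∑ ω : Fin m → Fin d → Bool, ∑ i ∈ s, P i ω := by
    calc ((2:ℝ) ^ d) ^ m = ∑ ω : Fin m → Fin d → Bool, (1:ℝ) := by simp
      _ ≤ _ := Finset.sum_le_sum fun ω _ => hlb ω
  rw [Finset.sum_comm] at hcard
  have h5 : ∑ i ∈ s, ∑ ω, P i ω ≤ (2 ^ d) ^ m * ∑ i, 2 * Real.exp (-(m * δ i ^ 2 / 800)) := by
    rw [Finset.mul_sum]
    refine (Finset.sum_le_sum hub).trans ?_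
    exact Finset.sum_le_sum_of_subset_of_nonneg (Finset.subset_univ _)
      fun i _ _ => by positivity
  have hpos : (0:ℝ) < (2 ^ d) ^ m := by positivity
  nlinarith

/-- Matrix form. -/
lemma chd_matrix {ι : Type*} [Fintype ι] {d m : ℕ} (hm : 0 < m)
    (z : ι → EuclideanSpace ℝ (Fin d)) (δ : ι → ℝ)
    (hδ0 : ∀ i, 0 ≤ δ i) (hδ : ∀ i, δ i ≤ 50)
    (hsum : ∑ i, 2 * Real.exp (-(m * δ i ^ 2 / 800)) < 1) :
    ∃ M : Matrix (Fin m) (Fin d) ℝ, ∀ i,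
      |‖Matrix.toEuclideanLin M (z i)‖ ^ 2 - ‖z i‖ ^ 2| ≤ δ i * ‖z i‖ ^ 2 := by
  obtain ⟨ω, hω⟩ := chd_jl (m := m) (fun i j => z i j) δ hδ0 hδ hsum
  have hm' : (0:ℝ) < m := by exact_mod_cast hm
  refine ⟨Matrix.of fun r j => chdSgn (ω r j) / √m, fun i => ?_⟩
  have h1 : ‖Matrix.toEuclideanLin (Matrix.of fun r j => chdSgn (ω r j) / √m) (z i)‖ ^ 2
      = (∑ r, chdX (fun j => z i j) (ω r) ^ 2) / m := by
    rw [EuclideanSpace.norm_sq_eq, Finset.sum_div]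
    refine Finset.sum_congr rfl fun r _ => ?_
    have : (Matrix.toEuclideanLin (Matrix.of fun r j => chdSgn (ω r j) / √m) (z i)) r
        = chdX (fun j => z i j) (ω r) / √m := by
      simp [Matrix.toLpLin_apply, Matrix.mulVec, dotProduct, chdX, Finset.sum_div]
      refine Finset.sum_congr rfl fun j _ => by ring
    rw [this, Real.norm_eq_abs, sq_abs, div_pow, Real.sq_sqrt hm'.le]
  have h2 : ‖z i‖ ^ 2 = ∑ j, z i j ^ 2 := by
    rw [EuclideanSpace.norm_sq_eq]; simp
  have := hω i
  rw [← h2] at this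
  rw [h1]
  have e : (∑ r, chdX (fun j => z i j) (ω r) ^ 2) / m - ‖z i‖ ^ 2
      = (∑ r, chdX (fun j => z i j) (ω r) ^ 2 - m * ‖z i‖ ^ 2) / m := by
    field_simp
  rw [e, abs_div, abs_of_pos hm', div_le_iff₀ hm']
  linarith

lemma chd_hull {n : ℕ} {E : Type*} [AddCommGroup E] [Module ℝ E] (x : Fin n → E) (y : E)
    (hy : y ∈ convexHull ℝ (Set.range x)) :
    ∃ p : Fin n → ℝ, (∀ i, 0 ≤ p i) ∧ ∑ i, p i = 1 ∧ ∑ i, p i • x i = y := by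
  have : convexHull ℝ (Set.range x) ⊆ (Fintype.linearCombination ℝ x) '' stdSimplex ℝ (Fin n) := by
    refine convexHull_min ?_ ((convex_stdSimplex ℝ _).linear_image _)
    rintro _ ⟨i, rfl⟩
    exact ⟨Pi.single i 1, single_mem_stdSimplex ℝ i, by simp⟩
  obtain ⟨p, hp, rfl⟩ := this hy
  exact ⟨p, hp.1, hp.2, by simp [Fintype.linearCombination_apply]⟩

set_option maxHeartbeats 2000000 in
theorem exists_chd_matrix :
    ∃ C : ℝ, 0 < C ∧
      ∀ (d n : ℕ) (ε : ℝ), 0 < ε → ε < 1 → 2 ≤ n →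
        ∀ x : Fin n → EuclideanSpace ℝ (Fin d), (∀ i, ‖x i‖ = 1) →
          ∃ m : ℕ, (m : ℝ) ≤ C * ε⁻¹ ^ 2 * Real.log n ∧
            ∃ M : Matrix (Fin m) (Fin d) ℝ,
              ProvidesConvexHullDistortion ε M (Set.range x) := by
  refine ⟨691200, by norm_num, ?_⟩
  intro d n ε hε hε1 hn x hx
  have hn' : (2:ℝ) ≤ n := by exact_mod_cast hn
  have hlog : (1:ℝ)/2 ≤ Real.log n := by
    have h1 := Real.log_two_gt_d9
    have h2 := Real.log_le_log (by norm_num) hn'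
    linarith
  have hinv : 1 ≤ ε⁻¹ ^ 2 := one_le_pow₀ (one_le_inv_iff₀.2 ⟨hε, hε1.le⟩)
  set V := 691200 * ε⁻¹ ^ 2 * Real.log n with hV
  have hV2 : 2 ≤ V := by rw [hV]; nlinarith
  set m := ⌊V⌋₊ with hm
  have hmV : (m:ℝ) ≤ V := Nat.floor_le (by linarith)
  have hmV' : V / 2 ≤ m := by
    have := Nat.lt_floor_add_one V
    rw [← hm] at this
    linarith
  have hm0 : 0 < m := by
    have : (0:ℝ) < m := by linarith
    exact_mod_cast this
  refine ⟨m, hmV, ?_⟩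
  set K := ⌊3 * ε⁻¹ ^ 2⌋₊ with hK
  have hKle : (K:ℝ) ≤ 3 * ε⁻¹ ^ 2 := Nat.floor_le (by positivity)
  have hεε : ε ^ 2 * ε⁻¹ ^ 2 = 1 := by field_simp
  have hsq : ∀ k : ℕ, √(k:ℝ) ^ 2 = k := fun k => Real.sq_sqrt (Nat.cast_nonneg k)
  let ι := Σ k : Fin K, (Fin (k.1 + 1) → Fin n)
  obtain ⟨M, hM⟩ := chd_matrix (ι := ι) (m := m) hm0 (fun q => ∑ j, x (q.2 j))
    (fun q => ε * √((q.1.1 + 1 : ℕ) : ℝ) / 12) (fun q => by positivity) (by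
      rintro ⟨⟨k, hk⟩, f⟩
      have h1 : ((k + 1 : ℕ) : ℝ) ≤ K := by exact_mod_cast hk
      have h2 : (ε * √((k + 1 : ℕ) : ℝ)) ^ 2 ≤ 3 := by
        rw [mul_pow, hsq]
        calc ε ^ 2 * ((k + 1 : ℕ) : ℝ) ≤ ε ^ 2 * (3 * ε⁻¹ ^ 2) := by gcongr; exact h1.trans hKle
          _ = 3 := by linarith
      show ε * √((k + 1 : ℕ) : ℝ) / 12 ≤ 50
      nlinarith) (by
      rw [Fintype.sum_sigma]
      have hterm : ∀ k : Fin K, ∑ f : Fin (k.1 + 1) → Fin n,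
          2 * Real.exp (-(m * (ε * √((k.1 + 1 : ℕ) : ℝ) / 12) ^ 2 / 800))
          ≤ 2 * (1/4) * (1/4 : ℝ) ^ k.1 := by
        intro k
        have hnpos : (0:ℝ) < n := by linarith
        rw [Finset.sum_const, Finset.card_univ, Fintype.card_fun, Fintype.card_fin,
          Fintype.card_fin, nsmul_eq_mul, div_pow, mul_pow, hsq]
        have h1 : 3 * ((k.1 + 1 : ℕ) : ℝ) * Real.log n
            ≤ m * (ε ^ 2 * ((k.1 + 1 : ℕ) : ℝ) / 12 ^ 2) / 800 := by
          have : V / 2 * (ε ^ 2 * ((k.1 + 1 : ℕ) : ℝ) / 12 ^ 2) / 800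
              = 3 * ((k.1 + 1 : ℕ) : ℝ) * Real.log n * (ε ^ 2 * ε⁻¹ ^ 2) := by
            rw [hV]; ring
          rw [hεε, mul_one] at this
          rw [← this]
          gcongr
        have h2 : Real.exp (-(m * (ε ^ 2 * ((k.1 + 1 : ℕ) : ℝ) / 12 ^ 2) / 800))
            ≤ ((n:ℝ) ^ (k.1 + 1))⁻¹ ^ 3 := by
          calc _ ≤ Real.exp (-(3 * ((k.1 + 1 : ℕ) : ℝ) * Real.log n)) := by gcongr
            _ = _ := by
              rw [Real.exp_neg, inv_pow]
              congr 1
              rw [← pow_mul, ← Real.exp_log hnpos, ← Real.exp_nat_mul, Real.log_exp]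
              congr 1
              push_cast; ring
        have h3 : (2:ℝ) ^ (k.1 + 1) ≤ (n:ℝ) ^ (k.1 + 1) := by gcongr
        have hA : (0:ℝ) < (n:ℝ) ^ (k.1 + 1) := by positivity
        push_cast at h2 ⊢
        calc (n:ℝ) ^ (k.1 + 1) * (2 * Real.exp (-(m * (ε ^ 2 * ((k.1:ℝ) + 1) / 12 ^ 2) / 800)))
            ≤ (n:ℝ) ^ (k.1 + 1) * (2 * ((n:ℝ) ^ (k.1 + 1))⁻¹ ^ 3) := by gcongr
          _ = 2 * ((n:ℝ) ^ (k.1 + 1))⁻¹ ^ 2 := by field_simp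
          _ ≤ 2 * ((2:ℝ) ^ (k.1 + 1))⁻¹ ^ 2 := by gcongr
          _ = 2 * (1/4) * (1/4 : ℝ) ^ k.1 := by
            rw [← inv_pow, ← pow_mul, mul_comm (k.1 + 1) 2, pow_mul, pow_succ]; norm_num; ring
      have hfin : ∑ k : Fin K, 2 * (1/4) * (1/4 : ℝ) ^ k.1 < 1 := by
        rw [← Finset.mul_sum, Fin.sum_univ_eq_sum_range (fun k => (1/4 : ℝ) ^ k) K,
          geom_sum_eq (by norm_num)]
        have : (0:ℝ) < (1/4) ^ K := by positivity
        have e : 2 * (1/4) * (((1/4 : ℝ) ^ K - 1) / (1/4 - 1)) = 2/3 * (1 - (1/4 : ℝ) ^ K) := by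
          ring
        rw [e]
        linarith
      exact lt_of_le_of_lt (Finset.sum_le_sum fun k _ => hterm k) hfin)
  refine ⟨M, ?_⟩
  intro y hy
  obtain ⟨p, hp0, hp1, rfl⟩ := chd_hull x y hy
  set y := ∑ i, p i • x i with hy'
  set r := ‖y‖ with hr
  have hr0 : 0 ≤ r := norm_nonneg _
  have hr1 : r ≤ 1 := by
    rw [hr, hy']
    calc _ ≤ ∑ i, ‖p i • x i‖ := norm_sum_le _ _
      _ = 1 := by simp [norm_smul, hx, abs_of_nonneg (hp0 _), hp1]
  set ρ := max r ε with hρ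
  have hρε : ε ≤ ρ := le_max_right _ _
  have hρr : r ≤ ρ := le_max_left _ _
  have hρ1 : ρ ≤ 1 := max_le hr1 hε1.le
  have hρ0 : 0 < ρ := lt_of_lt_of_le hε hρε
  have hρinv : 1 ≤ ρ⁻¹ ^ 2 := one_le_pow₀ (one_le_inv_iff₀.2 ⟨hρ0, hρ1⟩)
  have hρρ : ρ ^ 2 * ρ⁻¹ ^ 2 = 1 := by field_simp
  set k0 := ⌈ρ⁻¹ ^ 2⌉₊ with hk0
  have hk0l : ρ⁻¹ ^ 2 ≤ k0 := Nat.le_ceil _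
  have hk0u : (k0:ℝ) < ρ⁻¹ ^ 2 + 1 := Nat.ceil_lt_add_one (by positivity)
  have hk01 : 1 ≤ k0 := by
    have : (1:ℝ) ≤ k0 := by linarith
    exact_mod_cast this
  have hk0K : k0 < K := by
    have h1 : ρ⁻¹ ^ 2 ≤ ε⁻¹ ^ 2 := by gcongr
    have : k0 + 1 ≤ K := Nat.le_floor (by push_cast; linarith)
    omega
  have hdet := chd_det (Matrix.toEuclideanLin M) p hp1 hp0 x hx (k0 + 1) (by omega)
    (ε * √((k0 + 1 : ℕ) : ℝ) / 12) (fun f => hM ⟨⟨k0, hk0K⟩, f⟩)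
  rw [← hy', ← hr] at hdet
  set a := ‖Matrix.toEuclideanLin M y‖ with ha
  have ha0 : 0 ≤ a := norm_nonneg _
  set s := √((k0 + 1 : ℕ) : ℝ) with hs
  have hs0 : 0 ≤ s := Real.sqrt_nonneg _
  have hs2 : s ^ 2 = k0 + 1 := by rw [hs, hsq]; push_cast; ring
  have hsρ : s * ρ ≤ 2 := by
    have : (s * ρ) ^ 2 ≤ 3 := by
      rw [mul_pow, hs2]
      nlinarith [sq_nonneg ρ]
    nlinarith
  have hk0p : (0:ℝ) < k0 := by exact_mod_cast hk01
  have hkey : |a ^ 2 - r ^ 2| ≤ ε * ρ / 2 := by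
    have e : (((k0 + 1 : ℕ) : ℝ) - 1) = k0 := by push_cast; ring
    rw [e] at hdet
    refine le_of_mul_le_mul_left (a := (k0:ℝ)) (hdet.trans ?_) hk0p
    have h1 : (1:ℝ) ≤ k0 * ρ ^ 2 := by nlinarith [sq_nonneg ρ]
    have h2 : k0 * r ^ 2 + 2 ≤ 3 * (k0 * ρ ^ 2) := by
      have : r ^ 2 ≤ ρ ^ 2 := by gcongr
      nlinarith
    calc ε * s / 12 * (k0 * r ^ 2 + 2) ≤ ε * s / 12 * (3 * (k0 * ρ ^ 2)) := by gcongr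
      _ = (ε * k0 * ρ / 4) * (s * ρ) := by ring
      _ ≤ (ε * k0 * ρ / 4) * 2 := by gcongr
      _ = _ := by ring
  have hfac : |a ^ 2 - r ^ 2| = |a - r| * (a + r) := by
    rw [show a ^ 2 - r ^ 2 = (a - r) * (a + r) by ring, abs_mul,
      abs_of_nonneg (add_nonneg ha0 hr0)]
  rw [hfac] at hkey
  by_contra hcon
  push Not at hcon
  have h1 : |a - r| ≤ a + r := by rw [abs_le]; constructor <;> linarith
  rcases le_total r ε with h | h
  · rw [hρ, max_eq_right h] at hkey
    nlinarith
  · rw [hρ, max_eq_left h] at hkey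
    nlinarith
end
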